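/- arXiv:2005.00150 — 5 statements merged into one kernel-verified Lean document; each statement's English description precedes it below -/
import Mathlib

section
/- Let p be an odd prime. Then the following identity of formal power series in X with integer coefficients holds: (1−X)(1−p²X²)(1−p³X³)(1−p⁴X⁴)(1−p⁵X⁶) · ∑_{n≥0} a_R(pⁿ)Xⁿ = 1 + pX² + p²X³ − p⁴X⁵ − 2p⁵X⁶ − 2p⁶X⁷ − p⁷X⁸ + p⁹X¹⁰ + p¹⁰X¹¹ + p¹¹X¹³. -/
/-- `R = ℤ[t]/(t⁴)`. -/
abbrev Rt4 : Type := Polynomial ℤ ⧸ Ideal.span ({Polynomial.X ^ 4} : Set (Polynomial ℤ))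

/-- `a_R(k)`: the number of (unital) subrings of `ℤ[t]/(t⁴)` of additive index `k`. -/
noncomputable def aR (k : ℕ) : ℕ :=
  Nat.card {S : Subring Rt4 // S.toAddSubgroup.index = k}

/-- The subgroup of `ℤ × B` generated by `(a, b)` and `0 × K`. -/
def extLattice {B : Type*} [AddCommGroup B] (a : ℤ) (K : AddSubgroup B) (b : B) :
    AddSubgroup (ℤ × B) where
  carrier := {x | ∃ i : ℤ, x.1 = a * i ∧ x.2 - i • b ∈ K}
  zero_mem' := ⟨0, by simp⟩
  add_mem' := by
    rintro x y ⟨i, hi, hi'⟩ ⟨j, hj, hj'⟩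
    refine ⟨i + j, by simp [hi, hj, mul_add], ?_⟩
    convert K.add_mem hi' hj' using 1
    simp only [Prod.snd_add, add_smul]
    abel
  neg_mem' := by
    rintro x ⟨i, hi, hi'⟩
    refine ⟨-i, by simp [hi], ?_⟩
    convert K.neg_mem hi' using 1
    simp only [Prod.snd_neg, neg_smul]
    abel

section
variable {B : Type*} [AddCommGroup B]

theorem mem_extLattice {a : ℤ} {K : AddSubgroup B} {b : B} {x : ℤ × B} :
    x ∈ extLattice a K b ↔ ∃ i : ℤ, x.1 = a * i ∧ x.2 - i • b ∈ K := Iff.rfl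

theorem zero_mk_mem_extLattice {a : ℤ} (ha : a ≠ 0) {K : AddSubgroup B} {b y : B} :
    (0, y) ∈ extLattice a K b ↔ y ∈ K := by
  rw [mem_extLattice]
  constructor
  · rintro ⟨i, hi, h⟩
    obtain rfl : i = 0 := by simpa [ha] using hi.symm
    simpa using h
  · intro h
    exact ⟨0, by simp, by simpa using h⟩

theorem mk_mem_extLattice (a : ℤ) (K : AddSubgroup B) (b : B) : (a, b) ∈ extLattice a K b :=
  ⟨1, by simp, by simp⟩

theorem comap_inr_extLattice {a : ℤ} (ha : a ≠ 0) (K : AddSubgroup B) (b : B) :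
    (extLattice a K b).comap (AddMonoidHom.inr ℤ B) = K := by
  ext y
  simpa using zero_mk_mem_extLattice ha

theorem map_fst_extLattice (a : ℤ) (K : AddSubgroup B) (b : B) :
    (extLattice a K b).map (AddMonoidHom.fst ℤ B) = AddSubgroup.zmultiples a := by
  ext x
  simp only [AddSubgroup.mem_map, AddMonoidHom.coe_fst, Int.mem_zmultiples_iff]
  constructor
  · rintro ⟨y, ⟨i, hi, -⟩, rfl⟩
    exact ⟨i, hi⟩
  · rintro ⟨i, rfl⟩
    exact ⟨(a * i, i • b), ⟨i, rfl, by simp⟩, rfl⟩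

theorem index_eq_index_map_fst_mul_index_comap_inr (L : AddSubgroup (ℤ × B)) :
    L.index = (L.map (AddMonoidHom.fst ℤ B)).index *
      (L.comap (AddMonoidHom.inr ℤ B)).index := by
  have hker : (AddMonoidHom.fst ℤ B).ker = (AddMonoidHom.inr ℤ B).range := by
    ext ⟨x, y⟩
    rw [AddMonoidHom.mem_ker, AddMonoidHom.mem_range]
    simp [eq_comm]
  have hsurj : (AddMonoidHom.fst ℤ B).range = ⊤ :=
    AddMonoidHom.range_eq_top.2 Prod.fst_surjective
  rw [AddSubgroup.index_map, AddSubgroup.index_comap, hsurj, AddSubgroup.index_top, mul_one,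
    ← hker, ← AddSubgroup.relIndex_mul_index (le_sup_left : L ≤ L ⊔ (AddMonoidHom.fst ℤ B).ker),
    sup_comm, AddSubgroup.relIndex_sup_right, mul_comm]

theorem index_extLattice {a : ℤ} (ha : a ≠ 0) (K : AddSubgroup B) (b : B) :
    (extLattice a K b).index = a.natAbs * K.index := by
  rw [index_eq_index_map_fst_mul_index_comap_inr, map_fst_extLattice, comap_inr_extLattice ha,
    Int.index_zmultiples]

theorem extLattice_inj {a a' : ℤ} (ha : 0 < a) (ha' : 0 < a') {K K' : AddSubgroup B} {b b' : B} :
    extLattice a K b = extLattice a' K' b' ↔ a = a' ∧ K = K' ∧ b - b' ∈ K := by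
  constructor
  · intro h
    have h1 : a = a' := by
      have := congrArg (AddSubgroup.map (AddMonoidHom.fst ℤ B)) h
      rw [map_fst_extLattice, map_fst_extLattice] at this
      apply Int.dvd_antisymm ha.le ha'.le
      · rw [← Int.mem_zmultiples_iff, this]; exact AddSubgroup.mem_zmultiples _
      · rw [← Int.mem_zmultiples_iff, ← this]; exact AddSubgroup.mem_zmultiples _
    have h2 : K = K' := by
      rw [← comap_inr_extLattice ha.ne' K b, h, comap_inr_extLattice ha'.ne']
    subst h1 h2
    refine ⟨rfl, rfl, ?_⟩
    have h3 : (a, b') ∈ extLattice a K b := h ▸ mk_mem_extLattice a K b'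
    rw [← zero_mk_mem_extLattice ha.ne' (b := b)]
    simpa using sub_mem (mk_mem_extLattice a K b) h3
  · rintro ⟨rfl, rfl, h⟩
    ext x
    simp only [mem_extLattice]
    refine exists_congr fun i => and_congr_right fun _ => ?_
    rw [← K.add_mem_cancel_right (K.zsmul_mem h i)]
    simp [smul_sub]

theorem exists_eq_extLattice {L : AddSubgroup (ℤ × B)} (hL : L.index ≠ 0) :
    ∃ a : ℤ, 0 < a ∧ ∃ b : B, L = extLattice a (L.comap (AddMonoidHom.inr ℤ B)) b := by
  obtain ⟨a, ha⟩ : ∃ a : ℤ, L.map (AddMonoidHom.fst ℤ B) = AddSubgroup.zmultiples a := by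
    obtain ⟨a, ha⟩ := Int.subgroup_cyclic (L.map (AddMonoidHom.fst ℤ B))
    exact ⟨a, by rw [ha, AddSubgroup.zmultiples_eq_closure]⟩
  wlog hpos : 0 < a generalizing a
  · refine this (-a) (by simpa using ha) ?_
    rcases lt_trichotomy a 0 with h | h | h
    · omega
    · rw [index_eq_index_map_fst_mul_index_comap_inr, ha, h, Int.index_zmultiples] at hL
      simp at hL
    · omega
  obtain ⟨⟨a', b⟩, hb, rfl⟩ : a ∈ L.map (AddMonoidHom.fst ℤ B) := by
    rw [ha]; exact AddSubgroup.mem_zmultiples _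
  simp only [AddMonoidHom.coe_fst] at ha hpos
  refine ⟨a', hpos, b, ?_⟩
  ext ⟨x, y⟩
  simp only [mem_extLattice, AddSubgroup.mem_comap, AddMonoidHom.inr_apply]
  constructor
  · intro h
    obtain ⟨i, rfl⟩ : a' ∣ x := by
      rw [← Int.mem_zmultiples_iff, ← ha]
      exact ⟨_, h, rfl⟩
    refine ⟨i, rfl, ?_⟩
    simpa [mul_comm] using sub_mem h (L.zsmul_mem hb i)
  · rintro ⟨i, rfl, h⟩
    simpa [mul_comm] using add_mem h (L.zsmul_mem hb i)

end

section
open Polynomial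

/-- The class of a polynomial in `ℤ[t]/(t⁴)`. -/
noncomputable def Rt4.mk : ℤ[X] →+* Rt4 := Ideal.Quotient.mk _

theorem Rt4.mk_surjective (r : Rt4) : ∃ f : ℤ[X], Rt4.mk f = r :=
  Ideal.Quotient.mk_surjective r

/-- The coefficient of `t ^ i` as an additive map. -/
noncomputable def Rt4.coeff (i : ℕ) : Rt4 →+ ℤ :=
  ((lcoeff ℤ i).comp (AdjoinRoot.modByMonicHom (monic_X_pow (R := ℤ) 4))).toAddMonoidHom

theorem Rt4.coeff_mk {i : ℕ} (hi : i < 4) (f : ℤ[X]) :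
    Rt4.coeff i (Rt4.mk f) = f.coeff i := by
  have h : Rt4.coeff i (Rt4.mk f) = (f %ₘ (X ^ 4)).coeff i := by
    rw [← AdjoinRoot.modByMonicHom_mk (monic_X_pow 4)]
    rfl
  rw [h]
  conv_rhs => rw [← modByMonic_add_div f (X ^ 4)]
  rw [Polynomial.coeff_add, coeff_X_pow_mul', if_neg (by omega), add_zero]

/-- The coordinates of an element of `Rt4` with respect to `t`, `t ^ 2`, `t ^ 3`. -/
noncomputable def Rt4.coords : Rt4 →+ ℤ × ℤ × ℤ :=
  (Rt4.coeff 1).prod ((Rt4.coeff 2).prod (Rt4.coeff 3))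

theorem Rt4.coords_apply (r : Rt4) :
    Rt4.coords r = (Rt4.coeff 1 r, Rt4.coeff 2 r, Rt4.coeff 3 r) := rfl

theorem Rt4.coords_surjective : Function.Surjective Rt4.coords := by
  rintro ⟨x, y, z⟩
  refine ⟨Rt4.mk (C x * X + C y * X ^ 2 + C z * X ^ 3), ?_⟩
  rw [Rt4.coords_apply, Rt4.coeff_mk (by decide), Rt4.coeff_mk (by decide),
    Rt4.coeff_mk (by decide)]
  simp [-eq_intCast, coeff_X_pow, coeff_C]

theorem Rt4.coords_mul (r s : Rt4) :
    Rt4.coords (r * s) = Rt4.coeff 0 r • Rt4.coords s + Rt4.coeff 0 s • Rt4.coords r +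
      (0, (Rt4.coords r).1 * (Rt4.coords s).1,
        (Rt4.coords r).1 * (Rt4.coords s).2.1 + (Rt4.coords r).2.1 * (Rt4.coords s).1) := by
  obtain ⟨f, rfl⟩ := Rt4.mk_surjective r
  obtain ⟨g, rfl⟩ := Rt4.mk_surjective s
  rw [← map_mul]
  simp only [Rt4.coords_apply, Rt4.coeff_mk (show 0 < 4 by decide),
    Rt4.coeff_mk (show 1 < 4 by decide), Rt4.coeff_mk (show 2 < 4 by decide),
    Rt4.coeff_mk (show 3 < 4 by decide), Polynomial.coeff_mul,
    Finset.Nat.sum_antidiagonal_eq_sum_range_succ_mk, Finset.sum_range_succ, Finset.sum_range_zero]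
  ext <;> simp <;> ring

theorem Rt4.coords_intCast (n : ℤ) : Rt4.coords n = 0 := by
  have h : (n : Rt4) = Rt4.mk (C n) := by simp
  rw [h, Rt4.coords_apply, Rt4.coeff_mk (by decide), Rt4.coeff_mk (by decide),
    Rt4.coeff_mk (by decide)]
  simp [-eq_intCast]

theorem Rt4.exists_intCast_of_coords_eq_zero {r : Rt4} (hr : Rt4.coords r = 0) :
    ∃ n : ℤ, (n : Rt4) = r := by
  obtain ⟨f, rfl⟩ := Rt4.mk_surjective r
  refine ⟨f.coeff 0, ?_⟩
  rw [Rt4.coords_apply, Rt4.coeff_mk (by decide), Rt4.coeff_mk (by decide),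
    Rt4.coeff_mk (by decide)] at hr
  simp only [Prod.mk_eq_zero] at hr
  have h : ((f.coeff 0 : ℤ) : Rt4) = Rt4.mk (C (f.coeff 0)) := by simp
  rw [h, eq_comm, Rt4.mk, Ideal.Quotient.eq, Ideal.mem_span_singleton, X_pow_dvd_iff]
  intro d hd
  interval_cases d <;> simp [-eq_intCast, coeff_C, hr]

/-- Closure under the product induced on the augmentation ideal `(t)` of `Rt4`. -/
def IsMulClosed (L : AddSubgroup (ℤ × ℤ × ℤ)) : Prop :=
  ∀ x ∈ L, ∀ y ∈ L, (0, x.1 * y.1, x.1 * y.2.1 + x.2.1 * y.1) ∈ L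

/-- Finite-index subrings of `Rt4` correspond to multiplicatively closed lattices. -/
noncomputable def subringEquivLattice (k : ℕ) :
    {S : Subring Rt4 // S.toAddSubgroup.index = k} ≃
      {L : AddSubgroup (ℤ × ℤ × ℤ) // IsMulClosed L ∧ L.index = k} :=
  have hker : ∀ S : Subring Rt4, Rt4.coords.ker ≤ S.toAddSubgroup := by
    intro S r hr
    obtain ⟨n, rfl⟩ := Rt4.exists_intCast_of_coords_eq_zero hr
    exact intCast_mem S n
  { toFun := fun S => ⟨S.1.toAddSubgroup.map Rt4.coords, by
      refine ⟨?_, ?_⟩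
      · rintro _ ⟨r, hr, rfl⟩ _ ⟨s, hs, rfl⟩
        refine ⟨r * s - Rt4.coeff 0 r • s - Rt4.coeff 0 s • r,
          sub_mem (sub_mem (S.1.mul_mem hr hs) (zsmul_mem hs _)) (zsmul_mem hr _), ?_⟩
        rw [map_sub, map_sub, map_zsmul, map_zsmul, Rt4.coords_mul]
        abel
      · rw [← AddSubgroup.index_comap_of_surjective _ Rt4.coords_surjective,
          AddSubgroup.comap_map_eq_self (hker S.1), S.2]⟩
    invFun := fun L => ⟨
      { L.1.comap Rt4.coords with
        one_mem' := by
          have h := Rt4.coords_intCast 1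
          rw [Int.cast_one] at h
          change Rt4.coords 1 ∈ L.1
          rw [h]
          exact zero_mem _
        mul_mem' := by
          intro r s hr hs
          change Rt4.coords (r * s) ∈ L.1
          rw [Rt4.coords_mul]
          exact add_mem (add_mem (zsmul_mem hs _) (zsmul_mem hr _)) (L.2.1 _ hr _ hs) },
      (AddSubgroup.index_comap_of_surjective _ Rt4.coords_surjective).trans L.2.2⟩
    left_inv := fun S => by
      refine Subtype.ext (SetLike.ext fun r => ?_)
      exact SetLike.ext_iff.1 (AddSubgroup.comap_map_eq_self (hker S.1)) r
    right_inv := fun L => Subtype.ext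
      (AddSubgroup.map_comap_eq_self_of_surjective Rt4.coords_surjective L.1) }

theorem aR_eq_card_lattice (k : ℕ) :
    aR k = Nat.card {L : AddSubgroup (ℤ × ℤ × ℤ) // IsMulClosed L ∧ L.index = k} :=
  Nat.card_congr (subringEquivLattice k)
end

theorem card_filter_range_dvd_mul_sub {N : ℕ} (hN : 0 < N) (m : ℕ) {u : ℤ}
    (hu : IsCoprime u N) (v : ℤ) :
    ((Finset.range (N * m)).filter fun x : ℕ => (N : ℤ) ∣ u * x - v).card = m := by
  obtain ⟨s, t, hst⟩ := hu
  have hN' : (N : ℤ) ≠ 0 := by exact_mod_cast hN.ne'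
  obtain ⟨x₀, hx₀⟩ : ∃ x₀ : ℕ, (x₀ : ℤ) = (s * v) % N :=
    ⟨((s * v) % N).toNat, Int.toNat_of_nonneg (Int.emod_nonneg _ hN')⟩
  have hx₁ : (N : ℤ) ∣ s * v - x₀ := hx₀ ▸ Int.dvd_self_sub_emod
  have key : ∀ x : ℕ, (N : ℤ) ∣ u * x - v ↔ x ≡ x₀ [MOD N] := by
    intro x
    rw [Nat.modEq_iff_dvd]
    obtain ⟨k, hk⟩ := hx₁
    constructor
    · rintro ⟨j, hj⟩
      exact ⟨-(t * x) - s * j - k, by linear_combination (x : ℤ) * hst - s * hj - hk⟩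
    · rintro ⟨j, hj⟩
      refine ⟨-(u * j) - u * k - t * v, ?_⟩
      linear_combination (-u) * hj - u * hk + v * hst
  rw [Finset.filter_congr fun x _ => key x, ← Nat.count_eq_card_filter_range,
    Nat.count_modEq_card _ hN, Nat.mul_div_cancel_left _ hN]
  simp

theorem card_filter_dvd_of_odd {p : ℕ} (hp : p.Prime) (hodd : Odd p) {a d f : ℕ}
    (hd : d ≤ 2 * a) (hf : f ≤ a + d) :
    ((Finset.range (p ^ d) ×ˢ Finset.range (p ^ f)).filter fun y : ℕ × ℕ =>
      (p : ℤ) ^ f ∣ 2 * p ^ a * y.1 - p ^ (2 * a - d) * y.2).card =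
      p ^ (d + min f (min a (2 * a - d))) := by
  have hp0 : (p : ℤ) ≠ 0 := by exact_mod_cast hp.ne_zero
  rcases le_total f (min a (2 * a - d)) with h | h
  · rw [min_eq_left h, Finset.filter_true_of_mem]
    · rw [Finset.card_product, Finset.card_range, Finset.card_range, pow_add]
    · intro y _
      have h1 : (p : ℤ) ^ f ∣ p ^ a := pow_dvd_pow _ (h.trans (min_le_left _ _))
      have h2 : (p : ℤ) ^ f ∣ p ^ (2 * a - d) := pow_dvd_pow _ (h.trans (min_le_right _ _))
      exact dvd_sub ((h1.mul_left _).mul_right _) (h2.mul_right _)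
  rw [min_eq_right h, Finset.card_filter]
  rcases le_total a (2 * a - d) with h' | h'
  · rw [min_eq_left h'] at h ⊢
    obtain ⟨s, rfl⟩ := Nat.exists_eq_add_of_le h
    obtain ⟨r, hr⟩ := Nat.exists_eq_add_of_le h'
    obtain ⟨m, rfl⟩ := Nat.exists_eq_add_of_le (show s ≤ d by omega)
    have hcop : IsCoprime (2 : ℤ) ((p ^ s : ℕ) : ℤ) := by
      have : Nat.Coprime 2 (p ^ s) := (Nat.coprime_two_left.2 hodd).pow_right s
      exact_mod_cast Nat.isCoprime_iff_coprime.2 this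
    rw [Finset.sum_product_right]
    have hfib : ∀ e ∈ Finset.range (p ^ (a + s)), (∑ b ∈ Finset.range (p ^ (s + m)),
        if (p : ℤ) ^ (a + s) ∣ 2 * p ^ a * (b : ℕ) - p ^ (2 * a - (s + m)) * (e : ℕ)
          then 1 else 0) = p ^ m := by
      intro e _
      rw [← Finset.card_filter, pow_add p s m]
      refine Eq.trans (congrArg Finset.card (Finset.filter_congr fun b _ => ?_))
        (card_filter_range_dvd_mul_sub (pow_pos hp.pos s) (p ^ m) hcop ((p : ℤ) ^ r * e))
      rw [hr, Nat.cast_pow]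
      refine Iff.trans (iff_of_eq ?_) (mul_dvd_mul_iff_left (pow_ne_zero a hp0))
      congr 1 <;> ring
    rw [Finset.sum_congr rfl hfib, Finset.sum_const, Finset.card_range, smul_eq_mul, ← pow_add]
    congr 1
    omega
  · rw [min_eq_right h'] at h ⊢
    obtain ⟨s, rfl⟩ := Nat.exists_eq_add_of_le h
    obtain ⟨r, hr⟩ := Nat.exists_eq_add_of_le h'
    rw [Finset.sum_product]
    generalize 2 * a - d = k at *
    subst hr
    have hcop : IsCoprime (-1 : ℤ) ((p ^ s : ℕ) : ℤ) := isCoprime_one_left.neg_left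
    have hfib : ∀ b ∈ Finset.range (p ^ d), (∑ e ∈ Finset.range (p ^ (k + s)),
        if (p : ℤ) ^ (k + s) ∣ 2 * p ^ (k + r) * (b : ℕ) - p ^ k * (e : ℕ)
          then 1 else 0) = p ^ k := by
      intro b _
      rw [← Finset.card_filter, pow_add p k s, mul_comm (p ^ k)]
      refine Eq.trans (congrArg Finset.card (Finset.filter_congr fun e _ => ?_))
        (card_filter_range_dvd_mul_sub (pow_pos hp.pos s) (p ^ k) hcop (-(2 * (p : ℤ) ^ r * b)))
      rw [Nat.cast_pow]
      refine Iff.trans (iff_of_eq ?_) (mul_dvd_mul_iff_left (pow_ne_zero k hp0))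
      congr 1 <;> ring
    rw [Finset.sum_congr rfl hfib, Finset.sum_const, Finset.card_range, smul_eq_mul, ← pow_add]

/-- The lattice spanned by `(a, b, c)`, `(0, d, e)` and `(0, 0, f)`. -/
def hermiteLattice (a d f b c e : ℤ) : AddSubgroup (ℤ × ℤ × ℤ) :=
  extLattice a (extLattice d (AddSubgroup.zmultiples f) e) (b, c)

theorem index_hermiteLattice {a d : ℤ} (ha : a ≠ 0) (hd : d ≠ 0) (f b c e : ℤ) :
    (hermiteLattice a d f b c e).index = a.natAbs * (d.natAbs * f.natAbs) := by
  rw [hermiteLattice, index_extLattice ha, index_extLattice hd, Int.index_zmultiples]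

theorem isMulClosed_extLattice {a : ℤ} (ha : a ≠ 0) {K : AddSubgroup (ℤ × ℤ)} {b c : ℤ} :
    IsMulClosed (extLattice a K (b, c)) ↔
      (∀ y ∈ K, ((0, a * y.1) : ℤ × ℤ) ∈ K) ∧ (a * a, 2 * a * b) ∈ K := by
  constructor
  · intro h
    refine ⟨fun y hy => ?_, ?_⟩
    · have := h _ (mk_mem_extLattice a K (b, c)) (0, y) ((zero_mk_mem_extLattice ha).2 hy)
      simpa [zero_mk_mem_extLattice ha] using this
    · have := h _ (mk_mem_extLattice a K (b, c)) _ (mk_mem_extLattice a K (b, c))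
      rw [zero_mk_mem_extLattice ha] at this
      convert this using 2
      ring
  · rintro ⟨h1, h2⟩ ⟨x, y⟩ ⟨i, hx, hy⟩ ⟨x', y'⟩ ⟨j, hx', hy'⟩
    rw [zero_mk_mem_extLattice ha]
    convert add_mem (K.zsmul_mem h2 (i * j))
      (add_mem (K.zsmul_mem (h1 _ hy') i) (K.zsmul_mem (h1 _ hy) j)) using 1
    simp only at hx hx'
    subst hx hx'
    ext <;> simp <;> ring

theorem isMulClosed_hermiteLattice {a d : ℤ} (ha : a ≠ 0) (hd : d ≠ 0) {f b c e : ℤ} :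
    IsMulClosed (hermiteLattice a d f b c e) ↔
      f ∣ a * d ∧ ∃ i, a * a = d * i ∧ f ∣ 2 * a * b - i * e := by
  rw [hermiteLattice, isMulClosed_extLattice ha]
  refine and_congr ⟨fun h => ?_, fun h y => ?_⟩ ?_
  · have := h _ (mk_mem_extLattice d _ e)
    rwa [zero_mk_mem_extLattice hd, Int.mem_zmultiples_iff] at this
  · rintro ⟨i, hi, -⟩
    rw [zero_mk_mem_extLattice hd, Int.mem_zmultiples_iff, hi, ← mul_assoc]
    exact h.mul_right i
  · simp [mem_extLattice, Int.mem_zmultiples_iff]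

theorem isMulClosed_hermiteLattice_pow {p : ℕ} (hp : p.Prime) {a d f : ℕ} {b c e : ℤ} :
    IsMulClosed (hermiteLattice ((p : ℤ) ^ a) ((p : ℤ) ^ d) ((p : ℤ) ^ f) b c e) ↔
      d ≤ 2 * a ∧ f ≤ a + d ∧ (p : ℤ) ^ f ∣ 2 * p ^ a * b - p ^ (2 * a - d) * e := by
  have hp0 : (p : ℤ) ≠ 0 := by exact_mod_cast hp.ne_zero
  have hpow : ∀ m n : ℕ, (p : ℤ) ^ m ∣ p ^ n ↔ m ≤ n := fun m n =>
    pow_dvd_pow_iff hp0 (Nat.prime_iff_prime_int.1 hp).not_isUnit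
  rw [isMulClosed_hermiteLattice (pow_ne_zero _ hp0) (pow_ne_zero _ hp0), ← pow_add, ← pow_add,
    hpow, ← two_mul]
  constructor
  · rintro ⟨hf, i, hi, h⟩
    have hd : d ≤ 2 * a := (hpow _ _).1 ⟨i, hi⟩
    refine ⟨hd, hf, ?_⟩
    obtain rfl : (p : ℤ) ^ (2 * a - d) = i := by
      apply mul_left_cancel₀ (pow_ne_zero d hp0)
      rw [← hi, ← pow_add, Nat.add_sub_cancel' hd]
    exact h
  · rintro ⟨hd, hf, h⟩
    exact ⟨hf, _, by rw [← pow_add, Nat.add_sub_cancel' hd], h⟩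

theorem natCast_inj_of_dvd_sub {N x y : ℕ} (hx : x < N) (hy : y < N) (h : (N : ℤ) ∣ x - y) :
    x = y := by
  have := (Nat.modEq_iff_dvd.2 h)
  exact (Nat.ModEq.eq_of_lt_of_lt this hy hx).symm

theorem hermiteLattice_inj {a d f b c e a' d' f' b' c' e' : ℕ} (ha : 0 < a) (ha' : 0 < a')
    (hd : 0 < d) (hd' : 0 < d') (hb : b < d) (hc : c < f) (he : e < f)
    (hb' : b' < d') (hc' : c' < f') (he' : e' < f')
    (h : hermiteLattice a d f b c e = hermiteLattice a' d' f' b' c' e') :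
    a = a' ∧ d = d' ∧ f = f' ∧ b = b' ∧ c = c' ∧ e = e' := by
  rw [hermiteLattice, hermiteLattice, extLattice_inj (by exact_mod_cast ha) (by exact_mod_cast ha'),
    extLattice_inj (by exact_mod_cast hd) (by exact_mod_cast hd')] at h
  obtain ⟨h1, ⟨h2, h3, h4⟩, h5⟩ := h
  rw [Int.mem_zmultiples_iff] at h4
  obtain rfl : a = a' := by exact_mod_cast h1
  obtain rfl : d = d' := by exact_mod_cast h2
  obtain rfl : f = f' := by
    simpa [Int.index_zmultiples] using congrArg AddSubgroup.index h3
  obtain rfl := natCast_inj_of_dvd_sub he he' h4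
  obtain ⟨i, hi, hi'⟩ := h5
  obtain rfl := natCast_inj_of_dvd_sub hb hb' ⟨i, hi⟩
  obtain rfl : i = 0 := by
    simpa [hd.ne'] using hi.symm
  rw [Int.mem_zmultiples_iff] at hi'
  exact ⟨rfl, rfl, rfl, rfl, natCast_inj_of_dvd_sub hc hc' (by simpa using hi'), rfl⟩

theorem exists_eq_hermiteLattice {L : AddSubgroup (ℤ × ℤ × ℤ)} (hL : L.index ≠ 0) :
    ∃ a d f b c e : ℕ, 0 < a ∧ 0 < d ∧ b < d ∧ c < f ∧ e < f ∧
      L = hermiteLattice a d f b c e := by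
  obtain ⟨a, ha, ⟨b, c⟩, hLK⟩ := exists_eq_extLattice hL
  set K := L.comap (AddMonoidHom.inr ℤ (ℤ × ℤ))
  have hK : K.index ≠ 0 := by
    intro h
    rw [hLK, index_extLattice ha.ne', h] at hL
    simp at hL
  obtain ⟨d, hd, e, hKM⟩ := exists_eq_extLattice hK
  set M := K.comap (AddMonoidHom.inr ℤ ℤ)
  have hM : M.index ≠ 0 := by
    intro h
    rw [hKM, index_extLattice hd.ne', h] at hK
    simp at hK
  obtain ⟨f, hf, hMf⟩ : ∃ f : ℕ, 0 < f ∧ M = AddSubgroup.zmultiples (f : ℤ) := by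
    obtain ⟨f, h⟩ := Int.subgroup_cyclic M
    rw [← AddSubgroup.zmultiples_eq_closure, ← Int.zmultiples_natAbs] at h
    refine ⟨f.natAbs, Nat.pos_of_ne_zero fun h0 => hM ?_, h⟩
    rw [h, h0, Int.index_zmultiples]
    rfl
  clear_value M K
  subst hMf
  lift a to ℕ using ha.le
  lift d to ℕ using hd.le
  have hf' : (f : ℤ) ≠ 0 := by exact_mod_cast hf.ne'
  have hred : ∀ {N : ℕ}, 0 < N → ∀ x : ℤ, ∃ y : ℕ, y < N ∧ (N : ℤ) ∣ x - y := by
    intro N hN x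
    have hN' : (0 : ℤ) < N := by exact_mod_cast hN
    refine ⟨(x % N).toNat, ?_, ?_⟩
    · have := Int.emod_lt_of_pos x hN'
      have := Int.emod_nonneg x hN'.ne'
      omega
    · rw [Int.toNat_of_nonneg (Int.emod_nonneg _ hN'.ne')]
      exact Int.dvd_self_sub_emod
  have hd0 : 0 < d := by exact_mod_cast hd
  have ha0 : 0 < a := by exact_mod_cast ha
  obtain ⟨e', he', he⟩ := hred hf e
  obtain ⟨b', hb', i, hi⟩ := hred hd0 b
  obtain ⟨c', hc', hc⟩ := hred hf (c - i * e')
  refine ⟨a, d, f, b', c', e', ha0, hd0, hb', hc', he', ?_⟩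
  have hK' : K = extLattice (d : ℤ) (AddSubgroup.zmultiples (f : ℤ)) (e' : ℤ) := by
    rw [hKM, extLattice_inj hd hd]
    exact ⟨rfl, rfl, Int.mem_zmultiples_iff.2 he⟩
  rw [hLK, hermiteLattice, extLattice_inj ha ha, ← hK']
  refine ⟨rfl, rfl, ?_⟩
  rw [hK']
  refine ⟨i, hi, Int.mem_zmultiples_iff.2 ?_⟩
  convert hc using 1
  simp
  ring

theorem aR_prime_pow {p : ℕ} (hp : p.Prime) (hodd : Odd p) (n : ℕ) :
    aR (p ^ n) = ∑ x ∈ Finset.Iic ((n, n, n) : ℕ × ℕ × ℕ) with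
        x.1 + x.2.1 + x.2.2 = n ∧ x.2.1 ≤ 2 * x.1 ∧ x.2.2 ≤ x.1 + x.2.1,
        p ^ (x.2.1 + x.2.2 + min x.2.2 (min x.1 (2 * x.1 - x.2.1))) := by
  set T := (Finset.Iic ((n, n, n) : ℕ × ℕ × ℕ)).filter fun x =>
    x.1 + x.2.1 + x.2.2 = n ∧ x.2.1 ≤ 2 * x.1 ∧ x.2.2 ≤ x.1 + x.2.1 with hT
  have memT : ∀ x, x ∈ T ↔ x.1 + x.2.1 + x.2.2 = n ∧ x.2.1 ≤ 2 * x.1 ∧ x.2.2 ≤ x.1 + x.2.1 := by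
    intro x
    simp only [hT, Finset.mem_filter, Finset.mem_Iic, Prod.le_def]
    omega
  let P : (x : ℕ × ℕ × ℕ) → Finset (ℕ × ℕ × ℕ) := fun x =>
    Finset.range (p ^ x.2.2) ×ˢ ((Finset.range (p ^ x.2.1) ×ˢ Finset.range (p ^ x.2.2)).filter
      fun y : ℕ × ℕ => (p : ℤ) ^ x.2.2 ∣ 2 * p ^ x.1 * y.1 - p ^ (2 * x.1 - x.2.1) * y.2)
  have hcard : (T.sigma P).card = ∑ x ∈ T,
      p ^ (x.2.1 + x.2.2 + min x.2.2 (min x.1 (2 * x.1 - x.2.1))) := by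
    rw [Finset.card_sigma]
    refine Finset.sum_congr rfl fun x hx => ?_
    obtain ⟨-, h1, h2⟩ := (memT x).1 hx
    rw [Finset.card_product, card_filter_dvd_of_odd hp hodd h1 h2, Finset.card_range, ← pow_add]
    congr 1
    omega
  have hp0 : (p : ℤ) ≠ 0 := by exact_mod_cast hp.ne_zero
  have memP : ∀ x y, y ∈ P x ↔ y.1 < p ^ x.2.2 ∧ (y.2.1 < p ^ x.2.1 ∧ y.2.2 < p ^ x.2.2) ∧
      (p : ℤ) ^ x.2.2 ∣ 2 * p ^ x.1 * y.2.1 - p ^ (2 * x.1 - x.2.1) * y.2.2 := by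
    intro x y
    simp [P]
  rw [aR_eq_card_lattice, ← hcard, ← Fintype.card_coe, ← Nat.card_eq_fintype_card]
  symm
  refine Nat.card_eq_of_bijective (fun z : T.sigma P =>
    (⟨hermiteLattice ((p : ℤ) ^ z.1.1.1) ((p : ℤ) ^ z.1.1.2.1) ((p : ℤ) ^ z.1.1.2.2)
      z.1.2.2.1 z.1.2.1 z.1.2.2.2, ?_, ?_⟩ :
      {L : AddSubgroup (ℤ × ℤ × ℤ) // IsMulClosed L ∧ L.index = p ^ n})) ⟨?_, ?_⟩
  · obtain ⟨hx, hy⟩ := Finset.mem_sigma.1 z.2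
    rw [isMulClosed_hermiteLattice_pow hp]
    exact ⟨((memT _).1 hx).2.1, ((memT _).1 hx).2.2, ((memP _ _).1 hy).2.2⟩
  · obtain ⟨hx, hy⟩ := Finset.mem_sigma.1 z.2
    rw [index_hermiteLattice (pow_ne_zero _ hp0) (pow_ne_zero _ hp0), Int.natAbs_pow,
      Int.natAbs_pow, Int.natAbs_pow, Int.natAbs_natCast, ← pow_add, ← pow_add, ← add_assoc,
      ((memT _).1 hx).1]
  · rintro ⟨⟨⟨a, d, f⟩, c, b, e⟩, hz⟩ ⟨⟨⟨a', d', f'⟩, c', b', e'⟩, hz'⟩ h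
    obtain ⟨hc, ⟨hb, he⟩, -⟩ := (memP _ _).1 (Finset.mem_sigma.1 hz).2
    obtain ⟨hc', ⟨hb', he'⟩, -⟩ := (memP _ _).1 (Finset.mem_sigma.1 hz').2
    have h' : hermiteLattice ((p ^ a : ℕ) : ℤ) ((p ^ d : ℕ) : ℤ) ((p ^ f : ℕ) : ℤ) b c e =
        hermiteLattice ((p ^ a' : ℕ) : ℤ) ((p ^ d' : ℕ) : ℤ) ((p ^ f' : ℕ) : ℤ) b' c' e' := by
      simpa using congrArg Subtype.val h
    obtain ⟨h1, h2, h3, rfl, rfl, rfl⟩ := hermiteLattice_inj (pow_pos hp.pos _) (pow_pos hp.pos _)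
      (pow_pos hp.pos _) (pow_pos hp.pos _) hb hc he hb' hc' he' h'
    obtain rfl := Nat.pow_right_injective hp.two_le h1
    obtain rfl := Nat.pow_right_injective hp.two_le h2
    obtain rfl := Nat.pow_right_injective hp.two_le h3
    rfl
  · rintro ⟨L, hL, hn⟩
    obtain ⟨a, d, f, b, c, e, ha, hd, hb, hc, he, rfl⟩ := exists_eq_hermiteLattice
      (L := L) (by rw [hn]; exact pow_ne_zero _ hp.ne_zero)
    have hidx : a * (d * f) = p ^ n := by
      rw [← hn, index_hermiteLattice (by exact_mod_cast ha.ne') (by exact_mod_cast hd.ne')]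
      simp
    obtain ⟨a, -, rfl⟩ := (Nat.dvd_prime_pow hp).1 (Dvd.intro _ hidx)
    obtain ⟨d, -, rfl⟩ := (Nat.dvd_prime_pow hp).1
      ((Dvd.intro _ rfl : d ∣ d * f).trans (Dvd.intro_left _ hidx))
    obtain ⟨f, -, rfl⟩ := (Nat.dvd_prime_pow hp).1
      ((Dvd.intro_left _ rfl : f ∣ p ^ d * f).trans (Dvd.intro_left _ hidx))
    rw [← pow_add, ← pow_add] at hidx
    have hsum := Nat.pow_right_injective hp.two_le hidx
    have hL' := hL
    simp only [Nat.cast_pow] at hL'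
    rw [isMulClosed_hermiteLattice_pow hp] at hL'
    refine ⟨⟨⟨(a, d, f), (c, b, e)⟩, Finset.mem_sigma.2 ⟨(memT _).2 ?_, (memP _ _).2 ?_⟩⟩, ?_⟩
    · exact ⟨by simpa [add_assoc] using hsum, hL'.1, hL'.2.1⟩
    · exact ⟨hc, ⟨hb, he⟩, hL'.2.2⟩
    · simp

section
open PowerSeries PowerSeries.WithPiTopology

theorem exists_hasSum_geometric (q : ℤ⟦X⟧) (hq : constantCoeff q = 0) :
    ∃ G : ℤ⟦X⟧, HasSum (fun i : ℕ => q ^ i) G ∧ (1 - q) * G = 1 :=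
  ⟨_, (summable_pow_of_constantCoeff_eq_zero hq).hasSum,
    one_sub_mul_tsum_pow_of_constantCoeff_eq_zero hq⟩

theorem summable_monomial {ι : Type*} (c : ι → ℤ) (deg : ι → ℕ)
    (h : ∀ n, {i | deg i = n}.Finite) :
    Summable fun i => (monomial (deg i) (c i) : ℤ⟦X⟧) := by
  rw [summable_iff_summable_coeff]
  intro n
  refine summable_of_hasFiniteSupport ((h n).subset fun i hi => ?_)
  by_contra hne
  refine hi ?_
  simp only [coeff_monomial]
  exact if_neg (Ne.symm hne)

theorem exists_hasSum_geometric_three (p : ℤ) (a b c d m n k l : ℕ)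
    (hm : m ≠ 0) (hn : n ≠ 0) (hk : k ≠ 0) :
    ∃ G : ℤ⟦X⟧, HasSum (fun x : ℕ × ℕ × ℕ => (monomial (l + m * x.1 + n * x.2.1 + k * x.2.2)
        (p ^ (d + a * x.1 + b * x.2.1 + c * x.2.2)) : ℤ⟦X⟧)) G ∧
      (1 - (p : ℤ⟦X⟧) ^ a * X ^ m) * (1 - (p : ℤ⟦X⟧) ^ b * X ^ n) *
        (1 - (p : ℤ⟦X⟧) ^ c * X ^ k) * G = (p : ℤ⟦X⟧) ^ d * X ^ l := by
  have key : ∀ e i : ℕ, (monomial i (p ^ e) : ℤ⟦X⟧) = (p : ℤ⟦X⟧) ^ e * X ^ i := by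
    intro e i
    rw [monomial_eq_C_mul_X_pow]
    simp
  obtain ⟨G₁, h₁, e₁⟩ := exists_hasSum_geometric ((p : ℤ⟦X⟧) ^ a * X ^ m) (by simp [hm])
  obtain ⟨G₂, h₂, e₂⟩ := exists_hasSum_geometric ((p : ℤ⟦X⟧) ^ b * X ^ n) (by simp [hn])
  obtain ⟨G₃, h₃, e₃⟩ := exists_hasSum_geometric ((p : ℤ⟦X⟧) ^ c * X ^ k) (by simp [hk])
  refine ⟨(p : ℤ⟦X⟧) ^ d * X ^ l * (G₁ * (G₂ * G₃)), ?_, ?_⟩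
  · have h₂₃ := h₂.mul h₃ (by
      refine (summable_monomial (fun x : ℕ × ℕ => p ^ (b * x.1 + c * x.2))
        (fun x => n * x.1 + k * x.2) fun N => ?_).congr fun x => by rw [key]; ring
      refine (Set.finite_Iic ((N, N) : ℕ × ℕ)).subset fun x hx => ?_
      have h1 := Nat.le_mul_of_pos_left x.1 (Nat.pos_of_ne_zero hn)
      have h2 := Nat.le_mul_of_pos_left x.2 (Nat.pos_of_ne_zero hk)
      simp only [Set.mem_ofPred_eq] at hx
      simp only [Set.mem_Iic, Prod.le_def]
      omega)
    refine HasSum.congr_fun ((h₁.mul h₂₃ (by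
      refine (summable_monomial (fun x : ℕ × ℕ × ℕ => p ^ (a * x.1 + b * x.2.1 + c * x.2.2))
        (fun x => m * x.1 + n * x.2.1 + k * x.2.2) fun N => ?_).congr fun x => by rw [key]; ring
      refine (Set.finite_Iic ((N, N, N) : ℕ × ℕ × ℕ)).subset fun x hx => ?_
      have h1 := Nat.le_mul_of_pos_left x.1 (Nat.pos_of_ne_zero hm)
      have h2 := Nat.le_mul_of_pos_left x.2.1 (Nat.pos_of_ne_zero hn)
      have h3 := Nat.le_mul_of_pos_left x.2.2 (Nat.pos_of_ne_zero hk)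
      simp only [Set.mem_ofPred_eq] at hx
      simp only [Set.mem_Iic, Prod.le_def]
      omega)).mul_left ((p : ℤ⟦X⟧) ^ d * X ^ l)) fun x => ?_
    rw [key]
    ring
  · linear_combination (p : ℤ⟦X⟧) ^ d * X ^ l *
      ((1 - (p : ℤ⟦X⟧) ^ b * X ^ n) * G₂ * ((1 - (p : ℤ⟦X⟧) ^ c * X ^ k) * G₃) * e₁ +
        (1 - (p : ℤ⟦X⟧) ^ c * X ^ k) * G₃ * e₂ + e₃)

theorem hasSum_ite_of_inverse {α β M : Type*} [AddCommMonoid M] [TopologicalSpace M]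
    {w : β → M} {G : M} {v : α → M} (hv : HasSum v G) (P : β → Prop) [DecidablePred P]
    (g : α → β) (h : β → α) (hg : ∀ y, P (g y)) (hhg : ∀ y, h (g y) = y)
    (hgh : ∀ x, P x → g (h x) = x) (hvw : ∀ y, v y = w (g y)) :
    HasSum (fun x => if P x then w x else 0) G := by
  rw [← (Function.LeftInverse.injective hhg).hasSum_iff]
  · have : (fun x => if P x then w x else 0) ∘ g = v := by
      funext y
      rw [Function.comp_apply, if_pos (hg y), hvw]
    rwa [this]
  · intro x hx
    exact if_neg fun hP => hx ⟨h x, hgh x hP⟩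

theorem HasSum.ite_or {β M : Type*} [AddCommMonoid M] [TopologicalSpace M] [ContinuousAdd M]
    {w : β → M} {G H : M} {P Q : β → Prop} [DecidablePred P] [DecidablePred Q]
    (hG : HasSum (fun x => if P x then w x else 0) G)
    (hH : HasSum (fun x => if Q x then w x else 0) H) (hPQ : ∀ x, P x → ¬ Q x) :
    HasSum (fun x => if P x ∨ Q x then w x else 0) (G + H) := by
  refine (hG.add hH).congr_fun fun x => ?_
  by_cases hP : P x
  · simp [hP, hPQ x hP]
  · simp [hP]

theorem exists_hasSum_cone (p : ℤ) : ∃ F : ℤ⟦X⟧,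
    HasSum (fun x : ℕ × ℕ × ℕ => if x.2.1 ≤ 2 * x.1 ∧ x.2.2 ≤ x.1 + x.2.1 then
      (monomial (x.1 + x.2.1 + x.2.2)
        (p ^ (x.2.1 + x.2.2 + min x.2.2 (min x.1 (2 * x.1 - x.2.1)))) : ℤ⟦X⟧) else 0) F ∧
    (1 - (X : ℤ⟦X⟧)) * (1 - (p : ℤ⟦X⟧)^2 * X^2) *
        (1 - (p : ℤ⟦X⟧)^3 * X^3) * (1 - (p : ℤ⟦X⟧)^4 * X^4) *
        (1 - (p : ℤ⟦X⟧)^5 * X^6) * F =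
      1 + (p : ℤ⟦X⟧) * X^2 + (p : ℤ⟦X⟧)^2 * X^3
        - (p : ℤ⟦X⟧)^4 * X^5 - 2 * (p : ℤ⟦X⟧)^5 * X^6
        - 2 * (p : ℤ⟦X⟧)^6 * X^7 - (p : ℤ⟦X⟧)^7 * X^8
        + (p : ℤ⟦X⟧)^9 * X^10 + (p : ℤ⟦X⟧)^10 * X^11
        + (p : ℤ⟦X⟧)^11 * X^13 := by
  set w : ℕ × ℕ × ℕ → ℤ⟦X⟧ := fun x => monomial (x.1 + x.2.1 + x.2.2)
    (p ^ (x.2.1 + x.2.2 + min x.2.2 (min x.1 (2 * x.1 - x.2.1)))) with hw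
  obtain ⟨G₁, h₁, e₁⟩ := exists_hasSum_geometric_three p 3 1 2 0 3 2 3 0
    (by decide) (by decide) (by decide)
  obtain ⟨G₂, h₂, e₂⟩ := exists_hasSum_geometric_three p 4 3 2 4 4 3 3 4
    (by decide) (by decide) (by decide)
  obtain ⟨G₃, h₃, e₃⟩ := exists_hasSum_geometric_three p 4 5 2 3 4 6 3 4
    (by decide) (by decide) (by decide)
  obtain ⟨G₄, h₄, e₄⟩ := exists_hasSum_geometric_three p 4 5 2 4 4 6 3 5
    (by decide) (by decide) (by decide)
  obtain ⟨G₅, h₅, e₅⟩ := exists_hasSum_geometric_three p 4 5 2 5 4 6 3 6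
    (by decide) (by decide) (by decide)
  obtain ⟨G₆, h₆, e₆⟩ := exists_hasSum_geometric_three p 3 1 0 0 3 2 1 1
    (by decide) (by decide) (by decide)
  obtain ⟨G₇, h₇, e₇⟩ := exists_hasSum_geometric_three p 3 2 0 2 3 2 1 2
    (by decide) (by decide) (by decide)
  obtain ⟨G₈, h₈, e₈⟩ := exists_hasSum_geometric_three p 4 3 2 6 4 3 2 6
    (by decide) (by decide) (by decide)
  have hmono : ∀ {i j : ℕ} {e f : ℕ}, i = j → e = f →
      (monomial i (p ^ e) : ℤ⟦X⟧) = monomial j (p ^ f) := by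
    rintro i _ e _ rfl rfl
    rfl
  have k₁ := hasSum_ite_of_inverse (w := w) h₁
    (fun x => x.1 ≤ x.2.1 ∧ x.2.1 + x.2.2 ≤ 2 * x.1)
    (fun y => (y.1 + y.2.1 + y.2.2, y.1 + y.2.1 + 2 * y.2.2, y.1))
    (fun x => (x.2.2, 2 * x.1 - x.2.1 - x.2.2, x.2.1 - x.1))
    (fun y => by dsimp only; omega) (fun y => by ext <;> dsimp only <;> omega)
    (fun x hx => by ext <;> dsimp only <;> omega)
    (fun y => hmono (by dsimp only; omega) (by dsimp only; omega))
  have k₂ := hasSum_ite_of_inverse (w := w) h₂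
    (fun x => x.1 ≤ x.2.1 ∧ x.2.1 ≤ 2 * x.1 ∧ 2 * x.1 < x.2.1 + x.2.2 ∧
      x.2.2 ≤ 2 * (2 * x.1 - x.2.1))
    (fun y => (y.1 + 1 + y.2.1 + y.2.2, y.1 + 1 + y.2.1 + 2 * y.2.2, 2 * y.1 + 2 + y.2.1))
    (fun x => (x.2.2 - (2 * x.1 - x.2.1) - 1, 2 * (2 * x.1 - x.2.1) - x.2.2, x.2.1 - x.1))
    (fun y => by dsimp only; omega) (fun y => by ext <;> dsimp only <;> omega)
    (fun x hx => by ext <;> dsimp only <;> omega)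
    (fun y => hmono (by dsimp only; omega) (by dsimp only; omega))
  have k₃ := hasSum_ite_of_inverse (w := w) h₃
    (fun x => x.1 ≤ x.2.1 ∧ x.2.1 ≤ 2 * x.1 ∧ 2 * (2 * x.1 - x.2.1) < x.2.2 ∧
      x.2.2 ≤ x.1 + x.2.1 ∧ (x.2.2 - 2 * (2 * x.1 - x.2.1) - 1) % 3 = 0)
    (fun y => (y.1 + y.2.1 + 1 + y.2.2, y.1 + 2 * y.2.1 + 2 + 2 * y.2.2,
      2 * y.1 + 1 + 3 * y.2.1))
    (fun x => (2 * x.1 - x.2.1, (x.2.2 - 2 * (2 * x.1 - x.2.1) - 1) / 3,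
      x.2.1 - x.1 - 1 - (x.2.2 - 2 * (2 * x.1 - x.2.1) - 1) / 3))
    (fun y => by dsimp only; omega) (fun y => by ext <;> dsimp only <;> omega)
    (fun x hx => by ext <;> dsimp only <;> omega)
    (fun y => hmono (by dsimp only; omega) (by dsimp only; omega))
  have k₄ := hasSum_ite_of_inverse (w := w) h₄
    (fun x => x.1 ≤ x.2.1 ∧ x.2.1 ≤ 2 * x.1 ∧ 2 * (2 * x.1 - x.2.1) < x.2.2 ∧
      x.2.2 ≤ x.1 + x.2.1 ∧ (x.2.2 - 2 * (2 * x.1 - x.2.1) - 1) % 3 = 1)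
    (fun y => (y.1 + y.2.1 + 1 + y.2.2, y.1 + 2 * y.2.1 + 2 + 2 * y.2.2,
      2 * y.1 + 2 + 3 * y.2.1))
    (fun x => (2 * x.1 - x.2.1, (x.2.2 - 2 * (2 * x.1 - x.2.1) - 1) / 3,
      x.2.1 - x.1 - 1 - (x.2.2 - 2 * (2 * x.1 - x.2.1) - 1) / 3))
    (fun y => by dsimp only; omega) (fun y => by ext <;> dsimp only <;> omega)
    (fun x hx => by ext <;> dsimp only <;> omega)
    (fun y => hmono (by dsimp only; omega) (by dsimp only; omega))
  have k₅ := hasSum_ite_of_inverse (w := w) h₅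
    (fun x => x.1 ≤ x.2.1 ∧ x.2.1 ≤ 2 * x.1 ∧ 2 * (2 * x.1 - x.2.1) < x.2.2 ∧
      x.2.2 ≤ x.1 + x.2.1 ∧ (x.2.2 - 2 * (2 * x.1 - x.2.1) - 1) % 3 = 2)
    (fun y => (y.1 + y.2.1 + 1 + y.2.2, y.1 + 2 * y.2.1 + 2 + 2 * y.2.2,
      2 * y.1 + 3 + 3 * y.2.1))
    (fun x => (2 * x.1 - x.2.1, (x.2.2 - 2 * (2 * x.1 - x.2.1) - 1) / 3,
      x.2.1 - x.1 - 1 - (x.2.2 - 2 * (2 * x.1 - x.2.1) - 1) / 3))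
    (fun y => by dsimp only; omega) (fun y => by ext <;> dsimp only <;> omega)
    (fun x hx => by ext <;> dsimp only <;> omega)
    (fun y => hmono (by dsimp only; omega) (by dsimp only; omega))
  have k₆ := hasSum_ite_of_inverse (w := w) h₆
    (fun x => x.2.1 < x.1 ∧ x.2.2 ≤ x.2.1)
    (fun y => (y.1 + y.2.1 + 1 + y.2.2, y.1 + y.2.1, y.1))
    (fun x => (x.2.2, x.2.1 - x.2.2, x.1 - x.2.1 - 1))
    (fun y => by dsimp only; omega) (fun y => by ext <;> dsimp only <;> omega)
    (fun x hx => by ext <;> dsimp only <;> omega)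
    (fun y => hmono (by dsimp only; omega) (by dsimp only; omega))
  have k₇ := hasSum_ite_of_inverse (w := w) h₇
    (fun x => x.2.1 < x.2.2 ∧ x.2.2 ≤ x.1)
    (fun y => (y.1 + 1 + y.2.1 + y.2.2, y.1, y.1 + 1 + y.2.1))
    (fun x => (x.2.1, x.2.2 - x.2.1 - 1, x.1 - x.2.2))
    (fun y => by dsimp only; omega) (fun y => by ext <;> dsimp only <;> omega)
    (fun x hx => by ext <;> dsimp only <;> omega)
    (fun y => hmono (by dsimp only; omega) (by dsimp only; omega))
  have k₈ := hasSum_ite_of_inverse (w := w) h₈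
    (fun x => x.2.1 < x.1 ∧ x.1 < x.2.2 ∧ x.2.2 ≤ x.1 + x.2.1)
    (fun y => (y.1 + y.2.1 + 2 + y.2.2, y.1 + 1 + y.2.1, 2 * y.1 + y.2.1 + 3 + y.2.2))
    (fun x => (x.2.2 - x.1 - 1, x.2.1 - (x.2.2 - x.1), x.1 - x.2.1 - 1))
    (fun y => by dsimp only; omega) (fun y => by ext <;> dsimp only <;> omega)
    (fun x hx => by ext <;> dsimp only <;> omega)
    (fun y => hmono (by dsimp only; omega) (by dsimp only; omega))
  refine ⟨((((((G₁ + G₂) + G₃) + G₄) + G₅) + G₆) + G₇) + G₈, ?_, ?_⟩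
  · have := ((((((k₁.ite_or k₂ (by intro x; omega)).ite_or k₃ (by intro x; omega)).ite_or k₄
      (by intro x; omega)).ite_or k₅ (by intro x; omega)).ite_or k₆ (by intro x; omega)).ite_or k₇
      (by intro x; omega)).ite_or k₈ (by intro x; omega)
    refine this.congr_fun fun x => ?_
    refine if_congr ?_ rfl rfl
    omega
  · have hE : (1 - (p : ℤ⟦X⟧) * X ^ 2) * (1 - (p : ℤ⟦X⟧) ^ 2 * X ^ 3) ≠ 0 := by
      intro h
      simpa using congrArg constantCoeff h
    refine mul_left_cancel₀ hE ?_
    generalize (p : ℤ⟦X⟧) = q at *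
    generalize (X : ℤ⟦X⟧) = x at *
    linear_combination
      (1 - x) * (1 - q^2 * x^2) * (1 - q^4 * x^4) * (1 - q^5 * x^6) * e₁ +
      (1 - x) * (1 - q^2 * x^2) * (1 - q * x^2) * (1 - q^5 * x^6) * e₂ +
      (1 - x) * (1 - q^2 * x^2) * (1 - q * x^2) * (1 - q^3 * x^3) * (e₃ + e₄ + e₅) +
      (1 - q^2 * x^2) * (1 - q^2 * x^3) * (1 - q^4 * x^4) * (1 - q^5 * x^6) * e₆ +
      (1 - q * x^2) * (1 - q^2 * x^3) * (1 - q^4 * x^4) * (1 - q^5 * x^6) * e₇ +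
      (1 - x) * (1 - q * x^2) * (1 - q^2 * x^3) * (1 - q^5 * x^6) * e₈

theorem coeff_eq_sum_cone {p : ℤ} {F : ℤ⟦X⟧}
    (hF : HasSum (fun x : ℕ × ℕ × ℕ => if x.2.1 ≤ 2 * x.1 ∧ x.2.2 ≤ x.1 + x.2.1 then
      (monomial (x.1 + x.2.1 + x.2.2)
        (p ^ (x.2.1 + x.2.2 + min x.2.2 (min x.1 (2 * x.1 - x.2.1)))) : ℤ⟦X⟧) else 0) F)
    (n : ℕ) : coeff n F =
      ∑ x ∈ Finset.Iic ((n, n, n) : ℕ × ℕ × ℕ) with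
        x.1 + x.2.1 + x.2.2 = n ∧ x.2.1 ≤ 2 * x.1 ∧ x.2.2 ≤ x.1 + x.2.1,
        p ^ (x.2.1 + x.2.2 + min x.2.2 (min x.1 (2 * x.1 - x.2.1))) := by
  rw [hasSum_iff_hasSum_coeff] at hF
  rw [Finset.sum_filter]
  refine (hF n).unique (HasSum.congr_fun (hasSum_sum_of_ne_finset_zero
    (f := fun x : ℕ × ℕ × ℕ => if x.1 + x.2.1 + x.2.2 = n ∧ x.2.1 ≤ 2 * x.1 ∧ x.2.2 ≤ x.1 + x.2.1
      then p ^ (x.2.1 + x.2.2 + min x.2.2 (min x.1 (2 * x.1 - x.2.1))) else 0) fun x hx => ?_) fun x => ?_)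
  · refine if_neg fun h => hx ?_
    simp only [Finset.mem_Iic, Prod.le_def]
    omega
  · by_cases h : x.2.1 ≤ 2 * x.1 ∧ x.2.2 ≤ x.1 + x.2.1
    · simp [h, coeff_monomial, eq_comm]
    · simp [h]
end

open PowerSeries in
/-- For an odd prime `p`,
`(1−X)(1−p²X²)(1−p³X³)(1−p⁴X⁴)(1−p⁵X⁶) · ∑ₙ a_R(pⁿ)Xⁿ
  = 1 + pX² + p²X³ − p⁴X⁵ − 2p⁵X⁶ − 2p⁶X⁷ − p⁷X⁸ + p⁹X¹⁰ + p¹⁰X¹¹ + p¹¹X¹³`. -/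
theorem stmt_0 (p : ℕ) (hp : p.Prime) (hodd : Odd p) :
    (1 - (X : PowerSeries ℤ)) * (1 - (p : PowerSeries ℤ)^2 * X^2) *
        (1 - (p : PowerSeries ℤ)^3 * X^3) * (1 - (p : PowerSeries ℤ)^4 * X^4) *
        (1 - (p : PowerSeries ℤ)^5 * X^6) *
        (PowerSeries.mk fun n => (aR (p ^ n) : ℤ)) =
      1 + (p : PowerSeries ℤ) * X^2 + (p : PowerSeries ℤ)^2 * X^3
        - (p : PowerSeries ℤ)^4 * X^5 - 2 * (p : PowerSeries ℤ)^5 * X^6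
        - 2 * (p : PowerSeries ℤ)^6 * X^7 - (p : PowerSeries ℤ)^7 * X^8
        + (p : PowerSeries ℤ)^9 * X^10 + (p : PowerSeries ℤ)^10 * X^11
        + (p : PowerSeries ℤ)^11 * X^13 := by
  obtain ⟨F, hF, h⟩ := exists_hasSum_cone (p : ℤ)
  have hmk : (PowerSeries.mk fun n => (aR (p ^ n) : ℤ)) = F := by
    ext n
    rw [coeff_mk, coeff_eq_sum_cone hF, aR_prime_pow hp hodd]
    push_cast
    rfl
  rw [hmk]
  simpa only [Int.cast_natCast] using h
end

section
/- Let p be a prime, let k, l, r be nonnegative integers, and let a₂₁, a₃₁, a₃₂ ∈ ℤ_p. In the ring ℤ_p[t]/(t⁴), set v₁ = p^k·t³, v₂ = a₂₁·t³ + p^l·t², v₃ = a₃₁·t³ + a₃₂·t² + p^r·t, and v₄ = 1. Then the ℤ_p-submodule of ℤ_p[t]/(t⁴) spanned by {v₁, v₂, v₃, v₄} is closed under multiplication (i.e., v_i·v_j lies in this span for all 1 ≤ i, j ≤ 4) if and only if the following three conditions hold: l ≤ 2r, k ≤ l + r, and v_p(2p^l·a₃₂ − p^r·a₂₁) ≥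 k + l − r (where v_p(0) = ∞). -/
/-- `ℤ_p[t]/(t⁴)`. -/
abbrev Q4 (p : ℕ) [Fact p.Prime] : Type :=
  Polynomial ℤ_[p] ⧸ Ideal.span ({Polynomial.X ^ 4} : Set (Polynomial ℤ_[p]))

/-- The image `t` of the variable in `ℤ_p[t]/(t⁴)`. -/
noncomputable def tQ (p : ℕ) [Fact p.Prime] : Q4 p :=
  Ideal.Quotient.mk _ Polynomial.X

/-- The set `{v₁, v₂, v₃, v₄}` where `v₁ = pᵏt³`, `v₂ = a₂₁t³ + pˡt²`,
`v₃ = a₃₁t³ + a₃₂t² + pʳt`, `v₄ = 1`. -/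
noncomputable def genSet (p : ℕ) [Fact p.Prime] (k l r : ℕ) (a21 a31 a32 : ℤ_[p]) :
    Set (Q4 p) :=
  {((p : ℤ_[p]) ^ k) • (tQ p) ^ 3,
   a21 • (tQ p) ^ 3 + ((p : ℤ_[p]) ^ l) • (tQ p) ^ 2,
   a31 • (tQ p) ^ 3 + a32 • (tQ p) ^ 2 + ((p : ℤ_[p]) ^ r) • (tQ p),
   (1 : Q4 p)}

theorem tQ_pow_four (p : ℕ) [Fact p.Prime] : tQ p ^ 4 = 0 := by
  rw [tQ, ← map_pow]
  exact Ideal.Quotient.eq_zero_iff_mem.2 (Ideal.mem_span_singleton_self _)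

/-- The constant `a`, viewed in `ℤ_p[t]/(t⁴)`. -/
noncomputable def constQ (p : ℕ) [Fact p.Prime] : ℤ_[p] →+* Q4 p :=
  (Ideal.Quotient.mk _).comp Polynomial.C

theorem smul_eq_constQ_mul (p : ℕ) [Fact p.Prime] (a : ℤ_[p]) (x : Q4 p) :
    a • x = constQ p a * x := by
  obtain ⟨f, rfl⟩ := Ideal.Quotient.mk_surjective x
  rw [constQ, RingHom.comp_apply, ← map_mul, ← Polynomial.smul_eq_C_mul]
  rfl

/-- The powers `1, t, t², t³` are linearly independent over `ℤ_p`. -/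
theorem coeffs_eq_zero_of_tQ_combination_eq_zero (p : ℕ) [Fact p.Prime] (a b c d : ℤ_[p])
    (h : a • tQ p ^ 3 + b • tQ p ^ 2 + c • tQ p + d • (1 : Q4 p) = 0) :
    a = 0 ∧ b = 0 ∧ c = 0 ∧ d = 0 := by
  have hdvd : (Polynomial.X ^ 4 : Polynomial ℤ_[p]) ∣
      Polynomial.C a * Polynomial.X ^ 3 + Polynomial.C b * Polynomial.X ^ 2 +
        Polynomial.C c * Polynomial.X + Polynomial.C d := by
    rw [← Ideal.mem_span_singleton, ← Ideal.Quotient.eq_zero_iff_mem, ← h]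
    simp only [smul_eq_constQ_mul, constQ, RingHom.comp_apply, tQ, map_add, map_mul, map_pow, mul_one]
  rw [Polynomial.X_pow_dvd_iff] at hdvd
  have h0 := hdvd 0 (by norm_num)
  have h1 := hdvd 1 (by norm_num)
  have h2 := hdvd 2 (by norm_num)
  have h3 := hdvd 3 (by norm_num)
  simp [Polynomial.coeff_X, Polynomial.coeff_C, Polynomial.coeff_X_pow] at h0 h1 h2 h3
  exact ⟨h3, h2, h1, h0⟩

theorem mem_span_genSet (p : ℕ) [Fact p.Prime] (k l r : ℕ) (a21 a31 a32 : ℤ_[p]) (x : Q4 p) :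
    x ∈ Submodule.span ℤ_[p] (genSet p k l r a21 a31 a32) ↔
      ∃ c₁ c₂ c₃ c₄ : ℤ_[p],
        x = (c₁ * p ^ k + c₂ * a21 + c₃ * a31) • tQ p ^ 3 +
          (c₂ * p ^ l + c₃ * a32) • tQ p ^ 2 + (c₃ * p ^ r) • tQ p + c₄ • (1 : Q4 p) := by
  simp only [genSet, Submodule.mem_span_insert, Submodule.mem_span_singleton]
  constructor
  · rintro ⟨c₁, _, ⟨c₂, _, ⟨c₃, _, ⟨c₄, rfl⟩, rfl⟩, rfl⟩, rfl⟩
    exact ⟨c₁, c₂, c₃, c₄, by module⟩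
  · rintro ⟨c₁, c₂, c₃, c₄, rfl⟩
    exact ⟨c₁, _, ⟨c₂, _, ⟨c₃, _, ⟨c₄, rfl⟩, rfl⟩, rfl⟩, by module⟩

/-- A combination of `t³` and `t²` lies in the span iff it is a combination of `v₁` and `v₂`. -/
theorem smul_cube_add_smul_sq_mem_span_genSet_iff (p : ℕ) [Fact p.Prime] (k l r : ℕ)
    (a21 a31 a32 a b : ℤ_[p]) :
    a • tQ p ^ 3 + b • tQ p ^ 2 ∈ Submodule.span ℤ_[p] (genSet p k l r a21 a31 a32) ↔
      ∃ c₁ c₂ : ℤ_[p], a = c₁ * p ^ k + c₂ * a21 ∧ b = c₂ * p ^ l := by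
  have hp : (p : ℤ_[p]) ≠ 0 := PadicInt.prime_p.ne_zero
  rw [mem_span_genSet]
  constructor
  · rintro ⟨c₁, c₂, c₃, c₄, h⟩
    obtain ⟨h3, h2, h1, -⟩ := coeffs_eq_zero_of_tQ_combination_eq_zero p
      (a - (c₁ * p ^ k + c₂ * a21 + c₃ * a31)) (b - (c₂ * p ^ l + c₃ * a32))
      (-(c₃ * p ^ r)) (-c₄) (by rw [← sub_eq_zero] at h; rw [← h]; module)
    have hc : c₃ = 0 := by simpa [hp] using h1
    subst hc
    exact ⟨c₁, c₂, by linear_combination h3, by linear_combination h2⟩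
  · rintro ⟨c₁, c₂, rfl, rfl⟩
    exact ⟨c₁, c₂, 0, 0, by module⟩

/-- Only `v₂v₃` and `v₃²` impose a condition: the other products vanish or involve `v₄ = 1`. -/
theorem span_genSet_mul_closed_iff (p : ℕ) [Fact p.Prime] (k l r : ℕ) (a21 a31 a32 : ℤ_[p]) :
    (∀ x ∈ genSet p k l r a21 a31 a32, ∀ y ∈ genSet p k l r a21 a31 a32,
        x * y ∈ Submodule.span ℤ_[p] (genSet p k l r a21 a31 a32)) ↔
      ((p : ℤ_[p]) ^ (l + r)) • tQ p ^ 3 + (0 : ℤ_[p]) • tQ p ^ 2 ∈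
          Submodule.span ℤ_[p] (genSet p k l r a21 a31 a32) ∧
        (2 * a32 * (p : ℤ_[p]) ^ r) • tQ p ^ 3 + ((p : ℤ_[p]) ^ (2 * r)) • tQ p ^ 2 ∈
          Submodule.span ℤ_[p] (genSet p k l r a21 a31 a32) := by
  have ht := tQ_pow_four p
  set S := Submodule.span ℤ_[p] (genSet p k l r a21 a31 a32)
  set v₁ := ((p : ℤ_[p]) ^ k) • tQ p ^ 3 with hv₁
  set v₂ := a21 • tQ p ^ 3 + ((p : ℤ_[p]) ^ l) • tQ p ^ 2 with hv₂
  set v₃ := a31 • tQ p ^ 3 + a32 • tQ p ^ 2 + ((p : ℤ_[p]) ^ r) • tQ p with hv₃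
  have hgen : genSet p k l r a21 a31 a32 = {v₁, v₂, v₃, 1} := rfl
  have m₁ : v₁ ∈ S := Submodule.subset_span (by simp [hgen])
  have m₂ : v₂ ∈ S := Submodule.subset_span (by simp [hgen])
  have m₃ : v₃ ∈ S := Submodule.subset_span (by simp [hgen])
  have m₄ : (1 : Q4 p) ∈ S := Submodule.subset_span (by simp [hgen])
  have e₁₁ : v₁ * v₁ = 0 := by
    simp only [hv₁, smul_eq_constQ_mul]
    linear_combination constQ p (p ^ k) ^ 2 * tQ p ^ 2 * ht
  have e₁₂ : v₁ * v₂ = 0 := by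
    simp only [hv₁, hv₂, smul_eq_constQ_mul]
    linear_combination constQ p (p ^ k) *
      (constQ p a21 * tQ p ^ 2 + constQ p (p ^ l) * tQ p) * ht
  have e₁₃ : v₁ * v₃ = 0 := by
    simp only [hv₁, hv₃, smul_eq_constQ_mul]
    linear_combination constQ p (p ^ k) *
      (constQ p a31 * tQ p ^ 2 + constQ p a32 * tQ p +
        constQ p (p ^ r)) * ht
  have e₂₂ : v₂ * v₂ = 0 := by
    simp only [hv₂, smul_eq_constQ_mul]
    linear_combination (constQ p a21 * tQ p +
      constQ p (p ^ l)) ^ 2 * ht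
  have e₂₃ : v₂ * v₃ = ((p : ℤ_[p]) ^ (l + r)) • tQ p ^ 3 + (0 : ℤ_[p]) • tQ p ^ 2 := by
    simp only [hv₂, hv₃, smul_eq_constQ_mul, pow_add, map_mul, map_zero]
    linear_combination ((constQ p a21 * tQ p + constQ p (p ^ l)) *
      (constQ p a31 * tQ p + constQ p a32) +
      constQ p a21 * constQ p (p ^ r)) * ht
  have e₃₃ : v₃ * v₃ =
      (2 * a32 * (p : ℤ_[p]) ^ r) • tQ p ^ 3 + ((p : ℤ_[p]) ^ (2 * r)) • tQ p ^ 2 := by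
    simp only [hv₃, smul_eq_constQ_mul, two_mul, pow_add, map_mul, map_add, add_mul]
    linear_combination ((constQ p a31 * tQ p + constQ p a32) ^ 2 +
      2 * constQ p a31 * constQ p (p ^ r)) * ht
  rw [← e₂₃, ← e₃₃]
  simp only [hgen, Set.mem_insert_iff, Set.mem_singleton_iff, forall_eq_or_imp, forall_eq,
    mul_one, one_mul, mul_comm v₂ v₁, mul_comm v₃ v₁, mul_comm v₃ v₂, e₁₁, e₁₂, e₁₃, e₂₂,
    S.zero_mem, m₁, m₂, m₃, m₄, and_true, true_and]
  tauto

/-- The `ℤ_p`-span of `{v₁, v₂, v₃, v₄}` is closed under multiplication iff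
`l ≤ 2r`, `k ≤ l + r`, and `v_p(2pˡa₃₂ − pʳa₂₁) ≥ k + l − r` (with `v_p(0) = ∞`);
the valuation inequality is expressed as divisibility by `p^{max(k+l−r,0)}`. -/
theorem stmt_7 (p : ℕ) [Fact p.Prime] (k l r : ℕ) (a21 a31 a32 : ℤ_[p]) :
    (∀ x ∈ genSet p k l r a21 a31 a32, ∀ y ∈ genSet p k l r a21 a31 a32,
        x * y ∈ Submodule.span ℤ_[p] (genSet p k l r a21 a31 a32)) ↔
      (l ≤ 2 * r ∧ k ≤ l + r ∧
        (p : ℤ_[p]) ^ (((k : ℤ) + l - r).toNat) ∣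
          (2 * (p : ℤ_[p]) ^ l * a32 - (p : ℤ_[p]) ^ r * a21)) := by
  have hp : (p : ℤ_[p]) ≠ 0 := PadicInt.prime_p.ne_zero
  have hpow {m n : ℕ} : (p : ℤ_[p]) ^ m ∣ (p : ℤ_[p]) ^ n ↔ m ≤ n :=
    pow_dvd_pow_iff hp PadicInt.prime_p.not_isUnit
  rw [span_genSet_mul_closed_iff, smul_cube_add_smul_sq_mem_span_genSet_iff,
    smul_cube_add_smul_sq_mem_span_genSet_iff]
  have hcube : (∃ c₁ c₂ : ℤ_[p], (p : ℤ_[p]) ^ (l + r) = c₁ * p ^ k + c₂ * a21 ∧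
      0 = c₂ * (p : ℤ_[p]) ^ l) ↔ k ≤ l + r := by
    rw [← hpow]
    constructor
    · rintro ⟨c₁, c₂, h, h0⟩
      have hc : c₂ = 0 := by simpa [hp] using h0.symm
      exact ⟨c₁, by rw [h, hc]; ring⟩
    · rintro ⟨c, hc⟩
      exact ⟨c, 0, by rw [hc]; ring, by ring⟩
  have hsq : (∃ c₁ c₂ : ℤ_[p], 2 * a32 * (p : ℤ_[p]) ^ r = c₁ * p ^ k + c₂ * a21 ∧
      (p : ℤ_[p]) ^ (2 * r) = c₂ * p ^ l) ↔
      l ≤ 2 * r ∧ (p : ℤ_[p]) ^ (k + l) ∣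
        p ^ r * (2 * (p : ℤ_[p]) ^ l * a32 - (p : ℤ_[p]) ^ r * a21) := by
    rw [← hpow]
    constructor
    · rintro ⟨c₁, c₂, h, h'⟩
      refine ⟨⟨c₂, by rw [h', mul_comm]⟩, c₁, ?_⟩
      linear_combination (p : ℤ_[p]) ^ l * h - a21 * h'
    · rintro ⟨⟨c₂, h'⟩, c₁, h⟩
      refine ⟨c₁, c₂, mul_left_cancel₀ (pow_ne_zero l hp) ?_, by rw [h', mul_comm]⟩
      linear_combination h + a21 * h'
  have hval : (p : ℤ_[p]) ^ (k + l) ∣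
        p ^ r * (2 * (p : ℤ_[p]) ^ l * a32 - (p : ℤ_[p]) ^ r * a21) ↔
      (p : ℤ_[p]) ^ (((k : ℤ) + l - r).toNat) ∣
        (2 * (p : ℤ_[p]) ^ l * a32 - (p : ℤ_[p]) ^ r * a21) := by
    rcases le_total r (k + l) with h | h
    · have he : k + l = r + ((k : ℤ) + l - r).toNat := by omega
      rw [he, pow_add]
      exact mul_dvd_mul_iff_left (pow_ne_zero r hp)
    · have he : ((k : ℤ) + l - r).toNat = 0 := by omega
      rw [he, pow_zero]
      exact iff_of_true ((pow_dvd_pow _ h).mul_right _) (one_dvd _)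
  rw [hcube, hsq, hval]
  tauto
end

section
/- Let p be an odd prime and let k, l, r be integers with 1 ≤ k ≤ r and 1 ≤ l < r. Then the number of triples (a₂₁, a₃₁, a₃₂) of integers satisfying 0 ≤ a₂₁ < p^k, 0 ≤ a₃₁ < p^k, 0 ≤ a₃₂ < p^l, p^{k+l−r} divides 2p^l·a₃₂ − p^r·a₂₁ whenever k + l − r > 0, and gcd(p^{k+l+r}, p^{l+r}, p^r·a₂₁, a₂₁·a₃₂ − p^l·a₃₁, p^{k+r}, p^k·a₃₂, p^{k+l}) = 1, equals (p^{2k} − p^{2k−1})(p^l − p^{l−1}). -/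
/-- Exactly `p ^ n - p ^ (n - 1)` integers in `[0, p ^ n)` are not divisible by `p`. -/
theorem card_Ico_filter_not_dvd_prime_pow {p n : ℕ} (hp : p.Prime) (hn : 1 ≤ n) :
    ((Finset.Ico (0 : ℤ) ((p : ℤ) ^ n)).filter fun x => ¬ (p : ℤ) ∣ x).card =
      p ^ n - p ^ (n - 1) := by
  have htot : p ^ n - p ^ (n - 1) = (p ^ n).totient := by
    obtain ⟨m, rfl⟩ := Nat.exists_eq_add_of_le' hn
    rw [Nat.totient_prime_pow_succ hp, Nat.add_sub_cancel, pow_succ, Nat.mul_sub, mul_one]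
  rw [htot, Nat.totient_eq_card_coprime]
  symm
  refine Finset.card_bij (fun x _ => (x : ℤ)) ?_ (fun _ _ _ _ h => by exact_mod_cast h) ?_
  · intro x hx
    simp only [Finset.mem_filter, Finset.mem_range, Finset.mem_Ico,
      Nat.coprime_pow_left_iff hn, hp.coprime_iff_not_dvd] at hx ⊢
    exact ⟨⟨by positivity, by exact_mod_cast hx.1⟩, by exact_mod_cast hx.2⟩
  · intro y hy
    simp only [Finset.mem_filter, Finset.mem_Ico] at hy
    obtain ⟨⟨hy0, hyn⟩, hyp⟩ := hy
    lift y to ℕ using hy0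
    refine ⟨y, ?_, rfl⟩
    simp only [Finset.mem_filter, Finset.mem_range,
      Nat.coprime_pow_left_iff hn, hp.coprime_iff_not_dvd]
    exact ⟨by exact_mod_cast hyn, by exact_mod_cast hyp⟩

/-- A gcd with a power of a prime `q` is `1` iff `q` does not divide the gcd. -/
theorem gcd_prime_pow_eq_one_iff_not_dvd {M : Type*} [CommMonoidWithZero M]
    [NormalizedGCDMonoid M] {q : M} (hq : Prime q) (n : ℕ) (x : M) :
    gcd (q ^ n) x = 1 ↔ ¬ q ∣ gcd (q ^ n) x := by
  constructor
  · intro h hd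
    exact hq.not_isUnit (isUnit_of_dvd_one (h ▸ hd))
  · intro h
    obtain ⟨i, -, hi⟩ := (dvd_prime_pow hq n).1 (gcd_dvd_left (q ^ n) x)
    rcases Nat.eq_zero_or_pos i with rfl | hpos
    · rw [← normalize_gcd]
      exact normalize_eq_one.2 (associated_one_iff_isUnit.1 (by simpa using hi))
    · exact absurd ((dvd_pow_self q hpos.ne').trans hi.symm.dvd) h

/-- For an odd prime `p` and `1 ≤ k ≤ r`, `1 ≤ l < r`, the number of integer triples
`(a₂₁, a₃₁, a₃₂)` with `0 ≤ a₂₁, a₃₁ < pᵏ`, `0 ≤ a₃₂ < pˡ`,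
`p^{k+l−r} ∣ 2pˡa₃₂ − pʳa₂₁` whenever `k + l − r > 0`, and
`gcd(p^{k+l+r}, p^{l+r}, pʳa₂₁, a₂₁a₃₂ − pˡa₃₁, p^{k+r}, pᵏa₃₂, p^{k+l}) = 1`,
equals `(p^{2k} − p^{2k−1})(pˡ − p^{l−1})`. -/
theorem stmt_16 (p : ℕ) (hp : p.Prime) (hodd : Odd p) (k l r : ℕ)
    (hk1 : 1 ≤ k) (hkr : k ≤ r) (hl1 : 1 ≤ l) (hlr : l < r) :
    Nat.card {a : ℤ × ℤ × ℤ //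
        0 ≤ a.1 ∧ a.1 < (p : ℤ) ^ k ∧
        0 ≤ a.2.1 ∧ a.2.1 < (p : ℤ) ^ k ∧
        0 ≤ a.2.2 ∧ a.2.2 < (p : ℤ) ^ l ∧
        (r < k + l →
          (p : ℤ) ^ (k + l - r) ∣ 2 * (p : ℤ) ^ l * a.2.2 - (p : ℤ) ^ r * a.1) ∧
        gcd ((p : ℤ) ^ (k + l + r))
          (gcd ((p : ℤ) ^ (l + r))
            (gcd ((p : ℤ) ^ r * a.1)
              (gcd (a.1 * a.2.2 - (p : ℤ) ^ l * a.2.1)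
                (gcd ((p : ℤ) ^ (k + r))
                  (gcd ((p : ℤ) ^ k * a.2.2) ((p : ℤ) ^ (k + l))))))) = 1} =
      (p ^ (2 * k) - p ^ (2 * k - 1)) * (p ^ l - p ^ (l - 1)) := by
  have hq : Prime (p : ℤ) := Nat.prime_iff_prime_int.1 hp
  have hdvd : ∀ a b : ℤ,
      (p : ℤ) ^ (k + l - r) ∣ 2 * (p : ℤ) ^ l * b - (p : ℤ) ^ r * a := fun a b =>
    dvd_sub (((pow_dvd_pow _ (by omega)).mul_left _).mul_right _)
      ((pow_dvd_pow _ (by omega)).mul_right _)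
  have hpow : ∀ n : ℕ, 1 ≤ n → (p : ℤ) ∣ (p : ℤ) ^ n := fun n hn =>
    dvd_pow_self _ (by omega)
  have hgcd : ∀ a b c : ℤ,
      gcd ((p : ℤ) ^ (k + l + r))
          (gcd ((p : ℤ) ^ (l + r))
            (gcd ((p : ℤ) ^ r * a)
              (gcd (a * c - (p : ℤ) ^ l * b)
                (gcd ((p : ℤ) ^ (k + r))
                  (gcd ((p : ℤ) ^ k * c) ((p : ℤ) ^ (k + l))))))) = 1 ↔
        ¬ (p : ℤ) ∣ a ∧ ¬ (p : ℤ) ∣ c := by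
    intro a b c
    rw [gcd_prime_pow_eq_one_iff_not_dvd hq]
    simp only [dvd_gcd_iff, hpow (k + l + r) (by omega), hpow (l + r) (by omega),
      hpow (k + r) (by omega), hpow (k + l) (by omega),
      (hpow r (by omega)).mul_right a, (hpow k hk1).mul_right c, true_and, and_true,
      dvd_sub_left ((hpow l hl1).mul_right b), hq.dvd_mul, not_or]
  let S : ℕ → Finset ℤ := fun n =>
    (Finset.Ico (0 : ℤ) ((p : ℤ) ^ n)).filter fun x => ¬ (p : ℤ) ∣ x
  have hcard : (S k ×ˢ Finset.Ico (0 : ℤ) ((p : ℤ) ^ k) ×ˢ S l).card =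
      (p ^ (2 * k) - p ^ (2 * k - 1)) * (p ^ l - p ^ (l - 1)) := by
    have hIco : (Finset.Ico (0 : ℤ) ((p : ℤ) ^ k)).card = p ^ k := by
      rw [Int.card_Ico, sub_zero]
      exact_mod_cast Int.toNat_natCast (p ^ k)
    rw [Finset.card_product, Finset.card_product, hIco,
      card_Ico_filter_not_dvd_prime_pow hp hk1, card_Ico_filter_not_dvd_prime_pow hp hl1,
      ← mul_assoc, Nat.sub_mul, ← pow_add, ← pow_add, two_mul,
      show k - 1 + k = k + k - 1 by omega]
  rw [← hcard]
  refine Nat.subtype_card _ ?_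
  rintro ⟨a, b, c⟩
  simp only [S, Finset.mem_product, Finset.mem_filter, Finset.mem_Ico, hgcd, hdvd,
    implies_true, true_and]
  tauto
end

section
/- Let p be an odd prime and let k, l be integers with l ≥ 1 and l < k ≤ 2l. Then the number of triples (a₂₁, a₃₁, a₃₂) of integers satisfying 0 ≤ a₂₁ < p^k, 0 ≤ a₃₁ < p^k, 0 ≤ a₃₂ < p^l, p^{k−l} divides 2a₃₂ − a₂₁, and gcd(p^{k+2l}, p^{2l}, p^l·a₂₁, a₂₁·a₃₂ − p^l·a₃₁, p^{k+l}, p^k·a₃₂, p^{k+l}) = 1, equals p^k·(p^{2l} − p^{2l−1}). -/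
theorem card_Ico_filter_modEq_mul {n r : ℤ} (hr : 0 < r) (hn : 0 ≤ n) (v : ℤ) :
    (((Finset.Ico 0 (n * r)).filter (· ≡ v [ZMOD r])).card : ℤ) = n := by
  have hr' : (r : ℚ) ≠ 0 := by exact_mod_cast hr.ne'
  have h : (((n * r : ℤ) : ℚ) - v) / r = (((0 : ℤ) : ℚ) - v) / r + (n : ℤ) := by
    push_cast
    field_simp
    ring
  rw [Int.Ico_filter_modEq_card 0 (n * r) hr v, h, Int.ceil_add_intCast]
  simp [hn]

theorem card_Ico_filter_modEq_pow (p : ℕ) (hp : 0 < p) {m k : ℕ} (h : m ≤ k) (v : ℤ) :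
    ((Finset.Ico 0 ((p : ℤ) ^ k)).filter (· ≡ v [ZMOD (p : ℤ) ^ m])).card = p ^ (k - m) := by
  have := card_Ico_filter_modEq_mul (n := (p : ℤ) ^ (k - m)) (r := (p : ℤ) ^ m)
    (by positivity) (by positivity) v
  rw [← pow_add, Nat.sub_add_cancel h] at this
  exact_mod_cast this

theorem card_Ico_filter_not_dvd_pow (p : ℕ) (hp : 0 < p) {l : ℕ} (hl : 1 ≤ l) :
    ((Finset.Ico 0 ((p : ℤ) ^ l)).filter (¬ (p : ℤ) ∣ ·)).card = p ^ l - p ^ (l - 1) := by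
  have h := Finset.card_filter_add_card_filter_not (s := Finset.Ico 0 ((p : ℤ) ^ l))
    (fun x => (p : ℤ) ∣ x)
  have h' := card_Ico_filter_modEq_pow p hp hl 0
  simp only [pow_one, Int.modEq_zero_iff_dvd] at h'
  have hc : (Finset.Ico 0 ((p : ℤ) ^ l)).card = p ^ l := by
    rw [Int.card_Ico, sub_zero]
    exact_mod_cast Int.toNat_natCast (p ^ l)
  omega

theorem gcd_eq_one_iff_not_dvd (p : ℕ) (hp : p.Prime) (k l : ℕ) (hl : 1 ≤ l) (hk : 1 ≤ k)
    (a b c : ℤ) :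
    gcd ((p : ℤ) ^ (k + 2 * l))
      (gcd ((p : ℤ) ^ (2 * l))
        (gcd ((p : ℤ) ^ l * a)
          (gcd (a * c - (p : ℤ) ^ l * b)
            (gcd ((p : ℤ) ^ (k + l))
              (gcd ((p : ℤ) ^ k * c) ((p : ℤ) ^ (k + l))))))) = 1 ↔ ¬ (p : ℤ) ∣ a * c := by
  have hp' : Prime (p : ℤ) := Nat.prime_iff_prime_int.mp hp
  have hpow : ∀ {n : ℕ}, 1 ≤ n → (p : ℤ) ∣ (p : ℤ) ^ n := fun h => dvd_pow_self _ (by omega)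
  constructor
  · intro h hd
    refine hp'.not_isUnit (isUnit_of_dvd_one ?_)
    rw [← h]
    exact dvd_gcd (hpow (by omega)) <| dvd_gcd (hpow (by omega)) <|
      dvd_gcd ((hpow hl).mul_right _) <| dvd_gcd (dvd_sub hd ((hpow hl).mul_right _)) <|
      dvd_gcd (hpow (by omega)) <| dvd_gcd ((hpow hk).mul_right _) (hpow (by omega))
  · intro hd
    have hnd : ¬ (p : ℤ) ∣ a * c - (p : ℤ) ^ l * b := fun h =>
      hd ((dvd_sub_left ((hpow hl).mul_right b)).mp h)
    have hco : IsCoprime ((p : ℤ) ^ (k + 2 * l)) (a * c - (p : ℤ) ^ l * b) :=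
      ((Prime.coprime_iff_not_dvd hp').mpr hnd).pow_left
    rw [← normalize_gcd, normalize_eq_one]
    refine hco.isUnit_of_dvd' (gcd_dvd_left _ _) ?_
    exact (gcd_dvd_right _ _).trans <| (gcd_dvd_right _ _).trans <|
      (gcd_dvd_right _ _).trans <| gcd_dvd_left _ _

theorem dvd_mul_iff_of_dvd_two_mul_sub (p : ℕ) (hp : p.Prime) (hodd : Odd p) {a c : ℤ}
    (h : (p : ℤ) ∣ 2 * c - a) : (p : ℤ) ∣ a * c ↔ (p : ℤ) ∣ c := by
  have hp' : Prime (p : ℤ) := Nat.prime_iff_prime_int.mp hp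
  refine ⟨fun hd => (hp'.dvd_or_dvd hd).elim (fun ha => ?_) id, fun hc => hc.mul_left a⟩
  refine (hp'.dvd_or_dvd ((dvd_sub_left ha).mp h)).resolve_left fun h2 => ?_
  have h2' : p ∣ 2 := by exact_mod_cast h2
  rw [(Nat.prime_dvd_prime_iff_eq hp Nat.prime_two).mp h2'] at hodd
  exact absurd hodd (by decide)


/-- For an odd prime `p` and `l ≥ 1`, `l < k ≤ 2l`, the number of integer triples
`(a₂₁, a₃₁, a₃₂)` with `0 ≤ a₂₁, a₃₁ < pᵏ`, `0 ≤ a₃₂ < pˡ`, `p^{k−l} ∣ 2a₃₂ − a₂₁`, and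
`gcd(p^{k+2l}, p^{2l}, pˡa₂₁, a₂₁a₃₂ − pˡa₃₁, p^{k+l}, pᵏa₃₂, p^{k+l}) = 1`,
equals `pᵏ(p^{2l} − p^{2l−1})`. -/
theorem stmt_17 (p : ℕ) (hp : p.Prime) (hodd : Odd p) (k l : ℕ)
    (hl1 : 1 ≤ l) (hlk : l < k) (hk2l : k ≤ 2 * l) :
    Nat.card {a : ℤ × ℤ × ℤ //
        0 ≤ a.1 ∧ a.1 < (p : ℤ) ^ k ∧
        0 ≤ a.2.1 ∧ a.2.1 < (p : ℤ) ^ k ∧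
        0 ≤ a.2.2 ∧ a.2.2 < (p : ℤ) ^ l ∧
        (p : ℤ) ^ (k - l) ∣ 2 * a.2.2 - a.1 ∧
        gcd ((p : ℤ) ^ (k + 2 * l))
          (gcd ((p : ℤ) ^ (2 * l))
            (gcd ((p : ℤ) ^ l * a.1)
              (gcd (a.1 * a.2.2 - (p : ℤ) ^ l * a.2.1)
                (gcd ((p : ℤ) ^ (k + l))
                  (gcd ((p : ℤ) ^ k * a.2.2) ((p : ℤ) ^ (k + l))))))) = 1} =
      p ^ k * (p ^ (2 * l) - p ^ (2 * l - 1)) := by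
  have hpk : (p : ℤ) ∣ (p : ℤ) ^ (k - l) := dvd_pow_self _ (by omega)
  let S : Finset (Σ _ : ℤ, ℤ × ℤ) :=
    ((Finset.Ico 0 ((p : ℤ) ^ l)).filter (¬ (p : ℤ) ∣ ·)).sigma fun c =>
      (Finset.Ico 0 ((p : ℤ) ^ k)).filter (· ≡ 2 * c [ZMOD (p : ℤ) ^ (k - l)]) ×ˢ
        Finset.Ico 0 ((p : ℤ) ^ k)
  let e : ℤ × ℤ × ℤ ≃ Σ _ : ℤ, ℤ × ℤ :=
    { toFun := fun a => ⟨a.2.2, a.1, a.2.1⟩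
      invFun := fun s => (s.2.1, s.2.2, s.1)
      left_inv := fun _ => rfl
      right_inv := fun _ => rfl }
  have hS : S.card = p ^ k * (p ^ (2 * l) - p ^ (2 * l - 1)) := by
    have hc : (Finset.Ico 0 ((p : ℤ) ^ k)).card = p ^ k := by
      rw [Int.card_Ico, sub_zero]
      exact_mod_cast Int.toNat_natCast (p ^ k)
    simp only [S, Finset.card_sigma, Finset.card_product,
      card_Ico_filter_modEq_pow p hp.pos (Nat.sub_le k l), hc, Finset.sum_const,
      card_Ico_filter_not_dvd_pow p hp.pos hl1, smul_eq_mul]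
    rw [Nat.sub_sub_self hlk.le, show 2 * l - 1 = l + (l - 1) by omega, two_mul, pow_add,
      pow_add, ← Nat.mul_sub]
    ring
  rw [← hS, ← Nat.card_eq_finsetCard S]
  refine Nat.card_congr (e.subtypeEquiv fun a => ?_)
  obtain ⟨a, b, c⟩ := a
  simp only [e, S, Equiv.coe_fn_mk, Finset.mem_sigma, Finset.mem_filter, Finset.mem_product,
    Finset.mem_Ico, Int.modEq_iff_dvd, gcd_eq_one_iff_not_dvd p hp k l hl1 (by omega)]
  have key : (p : ℤ) ^ (k - l) ∣ 2 * c - a → ((p : ℤ) ∣ a * c ↔ (p : ℤ) ∣ c) := fun h =>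
    dvd_mul_iff_of_dvd_two_mul_sub p hp hodd (hpk.trans h)
  tauto
end

section
/- Let A be a ring (associative, with identity 1) whose underlying additive group is free abelian of finite rank n, and for a positive integer k let a_A(k) denote the number of subrings of A (unital subrings containing 1) of additive index k. Then a_A is multiplicative: for all positive integers m₁, m₂ with gcd(m₁, m₂) = 1, a_A(m₁·m₂) = a_A(m₁)·a_A(m₂). -/
/-- If every `m₁`-multiple lies in a finite-index subgroup, its index is coprime to every number
coprime to `m₁`. -/
theorem AddSubgroup.coprime_index_of_nsmul_mem {G : Type*} [AddCommGroup G]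
    {H : AddSubgroup G} {m₁ m₂ : ℕ} (hH : H.index ≠ 0) (hmem : ∀ a : G, m₁ • a ∈ H)
    (hco : m₁.Coprime m₂) : H.index.Coprime m₂ := by
  have : H.FiniteIndex := ⟨hH⟩
  refine Nat.Coprime.symm (Nat.coprime_of_dvd fun p hp hp₂ hpH => ?_)
  have : Fact p.Prime := ⟨hp⟩
  obtain ⟨q, hq⟩ := exists_prime_addOrderOf_dvd_card' (G := G ⧸ H) p hpH
  obtain ⟨a, rfl⟩ := QuotientAddGroup.mk_surjective q
  have hp₁ : p ∣ m₁ := by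
    rw [← hq, addOrderOf_dvd_iff_nsmul_eq_zero, ← QuotientAddGroup.mk_nsmul,
      QuotientAddGroup.eq_zero_iff]
    exact hmem a
  exact Nat.not_coprime_of_dvd_of_dvd hp.one_lt hp₁ hp₂ hco

theorem AddSubgroup.index_inf_of_coprime {G : Type*} [AddGroup G] {H K : AddSubgroup G}
    (hH : H.index ≠ 0) (hK : K.index ≠ 0) (hco : H.index.Coprime K.index) :
    (H ⊓ K).index = H.index * K.index :=
  le_antisymm AddSubgroup.index_inf_le <|
    Nat.le_of_dvd (Nat.pos_of_ne_zero (AddSubgroup.index_inf_ne_zero hH hK)) <|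
      hco.mul_dvd_of_dvd_of_dvd (AddSubgroup.index_dvd_of_le inf_le_left)
        (AddSubgroup.index_dvd_of_le inf_le_right)

theorem Subring.index_inf_of_coprime {A : Type*} [Ring A] {S T : Subring A} {m₁ m₂ : ℕ}
    (h₁ : 0 < m₁) (h₂ : 0 < m₂) (hco : m₁.Coprime m₂)
    (hS : S.toAddSubgroup.index = m₁) (hT : T.toAddSubgroup.index = m₂) :
    (S ⊓ T).toAddSubgroup.index = m₁ * m₂ := by
  have hinf : (S ⊓ T).toAddSubgroup = S.toAddSubgroup ⊓ T.toAddSubgroup := rfl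
  rw [hinf, AddSubgroup.index_inf_of_coprime (hS ▸ h₁.ne') (hT ▸ h₂.ne') (by rwa [hS, hT]), hS, hT]

/-- The subring `S + mA` of a ring `A`. -/
def Subring.addMultiples {A : Type*} [Ring A] (S : Subring A) (m : ℕ) : Subring A where
  carrier := {x | ∃ s ∈ S, ∃ a : A, x = s + m • a}
  zero_mem' := ⟨0, S.zero_mem, 0, by simp⟩
  one_mem' := ⟨1, S.one_mem, 0, by simp⟩
  add_mem' := by
    rintro _ _ ⟨s, hs, a, rfl⟩ ⟨t, ht, b, rfl⟩
    exact ⟨s + t, S.add_mem hs ht, a + b, by rw [smul_add]; abel⟩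
  neg_mem' := by
    rintro _ ⟨s, hs, a, rfl⟩
    exact ⟨-s, S.neg_mem hs, -a, by rw [smul_neg]; abel⟩
  mul_mem' := by
    rintro _ _ ⟨s, hs, a, rfl⟩ ⟨t, ht, b, rfl⟩
    refine ⟨s * t, S.mul_mem hs ht, s * b + a * t + m • (a * b), ?_⟩
    simp only [add_mul, mul_add, smul_add, smul_mul_assoc, mul_smul_comm]
    abel

namespace Subring

variable {A : Type*} [Ring A]

theorem le_addMultiples (S : Subring A) (m : ℕ) : S ≤ S.addMultiples m :=
  fun x hx => ⟨x, hx, 0, by simp⟩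

theorem nsmul_mem_addMultiples (S : Subring A) (m : ℕ) (a : A) : m • a ∈ S.addMultiples m :=
  ⟨0, S.zero_mem, a, by simp⟩

theorem nsmul_index_mem (S : Subring A) (a : A) : S.toAddSubgroup.index • a ∈ S :=
  S.toAddSubgroup.nsmul_index_mem a

theorem mem_of_coprime_nsmul_mem {S : Subring A} {m₁ m₂ : ℕ} (hco : m₁.Coprime m₂) {x : A}
    (h₁ : m₁ • x ∈ S) (h₂ : m₂ • x ∈ S) : x ∈ S := by
  have hbez : (m₁.gcdA m₂) • (m₁ • x) + (m₁.gcdB m₂) • (m₂ • x) = x := by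
    have h := Nat.gcd_eq_gcd_ab m₁ m₂
    rw [hco.gcd_eq_one] at h
    rw [← natCast_zsmul x m₁, ← natCast_zsmul x m₂, smul_smul, smul_smul, ← add_smul,
      mul_comm _ (m₁ : ℤ), mul_comm _ (m₂ : ℤ), ← h]
    simp
  rw [← hbez]
  exact S.add_mem (S.zsmul_mem h₁ _) (S.zsmul_mem h₂ _)

theorem addMultiples_inf_addMultiples {S : Subring A} {m₁ m₂ : ℕ} (hco : m₁.Coprime m₂)
    (hS : S.toAddSubgroup.index = m₁ * m₂) : S.addMultiples m₁ ⊓ S.addMultiples m₂ = S := by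
  refine le_antisymm ?_ (le_inf (S.le_addMultiples _) (S.le_addMultiples _))
  have hmem : ∀ a : A, (m₁ * m₂) • a ∈ S := fun a => hS ▸ S.nsmul_index_mem a
  rintro x ⟨⟨s, hs, a, hx⟩, ⟨t, ht, b, hx'⟩⟩
  refine mem_of_coprime_nsmul_mem hco ?_ ?_
  · rw [hx', smul_add, smul_smul]
    exact S.add_mem (S.nsmul_mem ht _) (hmem b)
  · rw [hx, smul_add, smul_smul, mul_comm]
    exact S.add_mem (S.nsmul_mem hs _) (hmem a)

theorem index_addMultiples_dvd {S : Subring A} {m₁ m₂ : ℕ} (h₁ : 0 < m₁) (h₂ : 0 < m₂)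
    (hco : m₁.Coprime m₂) (hS : S.toAddSubgroup.index = m₁ * m₂) :
    (S.addMultiples m₁).toAddSubgroup.index ∣ m₁ := by
  have hdvd : (S.addMultiples m₁).toAddSubgroup.index ∣ m₁ * m₂ :=
    hS ▸ AddSubgroup.index_dvd_of_le (S.le_addMultiples m₁)
  exact (AddSubgroup.coprime_index_of_nsmul_mem (ne_zero_of_dvd_ne_zero (by positivity) hdvd)
    (S.nsmul_mem_addMultiples m₁) hco).dvd_of_dvd_mul_right hdvd

theorem index_addMultiples {S : Subring A} {m₁ m₂ : ℕ} (h₁ : 0 < m₁) (h₂ : 0 < m₂)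
    (hco : m₁.Coprime m₂) (hS : S.toAddSubgroup.index = m₁ * m₂) :
    (S.addMultiples m₁).toAddSubgroup.index = m₁ := by
  have hd₁ := index_addMultiples_dvd h₁ h₂ hco hS
  have hd₂ := index_addMultiples_dvd h₂ h₁ hco.symm (hS.trans (mul_comm _ _))
  have hmul := index_inf_of_coprime (Nat.pos_of_dvd_of_pos hd₁ h₁)
    (Nat.pos_of_dvd_of_pos hd₂ h₂) (hco.of_dvd hd₁ hd₂) rfl rfl
  rw [addMultiples_inf_addMultiples hco hS, hS] at hmul
  refine Nat.dvd_antisymm hd₁ ((hco.of_dvd_right hd₂).dvd_of_dvd_mul_right ?_)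
  exact ⟨m₂, hmul.symm⟩

theorem addMultiples_inf {S T : Subring A} {m₁ m₂ : ℕ} (hco : m₁.Coprime m₂)
    (hS : S.toAddSubgroup.index = m₁) (hT : T.toAddSubgroup.index = m₂) :
    (S ⊓ T).addMultiples m₁ = S := by
  refine le_antisymm ?_ fun x hx => mem_of_coprime_nsmul_mem hco
    (nsmul_mem_addMultiples _ _ x)
    (le_addMultiples (S ⊓ T) _ (mem_inf.2 ⟨S.nsmul_mem hx _, hT ▸ T.nsmul_index_mem x⟩))
  rintro _ ⟨s, hs, a, rfl⟩
  exact S.add_mem hs.1 (hS ▸ S.nsmul_index_mem a)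

/-- For coprime `m₁, m₂`, subrings of index `m₁ * m₂` correspond to pairs of subrings of index
`m₁` and `m₂`, via `S ↦ (S + m₁A, S + m₂A)` and `(S, T) ↦ S ⊓ T`. -/
def indexMulEquiv (A : Type*) [Ring A] {m₁ m₂ : ℕ} (h₁ : 0 < m₁) (h₂ : 0 < m₂)
    (hco : m₁.Coprime m₂) :
    {S : Subring A // S.toAddSubgroup.index = m₁ * m₂} ≃
      {S : Subring A // S.toAddSubgroup.index = m₁} ×
        {S : Subring A // S.toAddSubgroup.index = m₂} where
  toFun S :=
    (⟨S.1.addMultiples m₁, index_addMultiples h₁ h₂ hco S.2⟩,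
      ⟨S.1.addMultiples m₂, index_addMultiples h₂ h₁ hco.symm (S.2.trans (mul_comm _ _))⟩)
  invFun P := ⟨P.1.1 ⊓ P.2.1, index_inf_of_coprime h₁ h₂ hco P.1.2 P.2.2⟩
  left_inv S := Subtype.ext (addMultiples_inf_addMultiples hco S.2)
  right_inv P := Prod.ext (Subtype.ext (addMultiples_inf hco P.1.2 P.2.2))
    (Subtype.ext (by
      change (P.1.1 ⊓ P.2.1).addMultiples m₂ = P.2.1
      rw [inf_comm]
      exact addMultiples_inf hco.symm P.2.2 P.1.2))

end Subring

/-- For a ring `A` whose additive group is free abelian of finite rank `n`, the counting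
function `k ↦ #{unital subrings of A of additive index k}` is multiplicative on coprime
arguments. -/
theorem stmt_18 (A : Type*) [Ring A] (n : ℕ) (hfree : Nonempty (A ≃+ (Fin n → ℤ)))
    (m₁ m₂ : ℕ) (hm₁ : 0 < m₁) (hm₂ : 0 < m₂) (hco : Nat.Coprime m₁ m₂) :
    Nat.card {S : Subring A // S.toAddSubgroup.index = m₁ * m₂} =
      Nat.card {S : Subring A // S.toAddSubgroup.index = m₁} *
        Nat.card {S : Subring A // S.toAddSubgroup.index = m₂} := by
  rw [← Nat.card_prod]
  exact Nat.card_congr (Subring.indexMulEquiv A hm₁ hm₂ hco)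
end
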